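/- Fix valences ς = (s_1, …, s_d) of positive integers with s_1 + ⋯ + s_d = 2N. Then for every ς-valenced link pattern α and every j ∈ {1, …, d}, the function U_α satisfies D_{s_j+1}^{(j)} U_α = 0 on the chamber 𝔛_d, where for m ≥ 1 the first-order operator ℒ_{−m}^{(j)} acts on smooth functions f on 𝔛_d by (ℒ_{−m}^{(j)} f)(x) = −Σ_{i ≠ j} ( (x_i − x_j)^{1−m} ∂f/∂x_i + (1 − m)(s_i + 1)s_i/2 · (x_i − x_j)^{−m} f(x) ), and D_{s_j+1}^{(j)} = Σ_{k=1}^{s_j+1} Σ_{m_1, …, m_k ≥ 1, m_1+⋯+m_k = s_j+1} ( (−2)^{s_j+1−k} (s_j!)² / ∏_{l=1}^{k−1} (m_1+⋯+m_l)(m_{l+1}+⋯+m_k) ) · ℒ_{−m_1}^{(j)} ∘ ⋯ ∘ ℒ_{−m_k}^{(j)}. -/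

import Mathlib

open scoped BigOperators Classical

namespace UST

/-- Partial sums of the valences: `q j = s_1 + ⋯ + s_j`. -/
def q (s : ℕ → ℕ) (j : ℕ) : ℕ := ∑ i ∈ Finset.range j, s i

/-- The group (0-based) of the 0-based position `t ∈ {0, …, 2N−1}`:
the unique `j` with `q j ≤ t < q (j+1)`. -/
def grp (d : ℕ) (s : ℕ → ℕ) (t : ℕ) : ℕ :=
  ((Finset.range d).filter (fun j => q s (j + 1) ≤ t)).card

/-- The 0-based offset of position `t` within its group. -/
def off (d : ℕ) (s : ℕ → ℕ) (t : ℕ) : ℕ := t - q s (grp d s t)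

/-- A (labeled) `N`-link pattern in left-to-right orientation: `β.1 k` and `β.2 k` are the
0-based left and right endpoints of the `k`-th link; the left endpoints increase, each link
satisfies `a_k < b_k`, the links partition `{0, …, 2N−1}`, and the pattern is noncrossing. -/
def isLP (N : ℕ) (β : (Fin N → Fin (2 * N)) × (Fin N → Fin (2 * N))) : Prop :=
  (∀ k l : Fin N, k < l → β.1 k < β.1 l) ∧
    (∀ k, β.1 k < β.2 k) ∧
    Function.Bijective (Sum.elim β.1 β.2) ∧
    ∀ k l, ¬(β.1 k < β.1 l ∧ β.1 l < β.2 k ∧ β.2 k < β.2 l)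

/-- The set of `N`-link patterns. -/
noncomputable def LP (N : ℕ) : Finset ((Fin N → Fin (2 * N)) × (Fin N → Fin (2 * N))) :=
  Finset.univ.filter (isLP N)

/-- The Dyck path of a link pattern: `path β t = #{k : a_k < t} − #{k : b_k < t}`. -/
def path (N : ℕ) (β : (Fin N → Fin (2 * N)) × (Fin N → Fin (2 * N))) (t : ℕ) : ℤ :=
  ((Finset.univ.filter (fun k : Fin N => ((β.1 k : ℕ)) < t)).card : ℤ) -
    ((Finset.univ.filter (fun k : Fin N => ((β.2 k : ℕ)) < t)).card : ℤ)

/-- The relation `β ≥_ς α`: the Dyck path of `β` dominates that of `α` and they agree at the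
group boundaries `q j`. -/
def geqVal (N d : ℕ) (s : ℕ → ℕ)
    (β α : (Fin N → Fin (2 * N)) × (Fin N → Fin (2 * N))) : Prop :=
  (∀ t, t ≤ 2 * N → path N α t ≤ path N β t) ∧
    ∀ j, j ≤ d → path N β (q s j) = path N α (q s j)

/-- `ς`-valenced link patterns: link patterns with no link inside a single group. -/
def valenced (N d : ℕ) (s : ℕ → ℕ)
    (α : (Fin N → Fin (2 * N)) × (Fin N → Fin (2 * N))) : Prop :=
  isLP N α ∧ ∀ k, grp d s (α.1 k : ℕ) ≠ grp d s (α.2 k : ℕ)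

/-- The fused symmetric kernel `𝔎` at the point `x = (x_1, …, x_d)` (0-based coordinates):
`𝔎(u,v) = 0` if `u, v` lie in the same group, and otherwise, with `u` in the earlier group
`i` at 1-based offset `m_u` and `v` in the later group `j` at 1-based offset `m_v`,
`𝔎(u,v) = (−1)^{m_v − 1} (m_u + m_v − 1)! / (π (x_j − x_i)^{m_u + m_v})`, i.e. the mixed
partial derivative `∂_{x_i}^{m_u−1} ∂_{x_j}^{m_v−1}` of `1/(π (x_i − x_j)²)`. -/
noncomputable def ker (d : ℕ) (s : ℕ → ℕ) (x : ℕ → ℝ) (u v : ℕ) : ℝ :=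
  if grp d s u = grp d s v then 0
  else
    let w : ℕ × ℕ := if grp d s u < grp d s v then (u, v) else (v, u)
    ((-1 : ℝ) ^ off d s w.2 * ((off d s w.1 + off d s w.2 + 1).factorial : ℝ)) /
      (Real.pi * (x (grp d s w.2) - x (grp d s w.1)) ^ (off d s w.1 + off d s w.2 + 2))

/-- The Fomin-type determinant `Δ_β` with the fused kernel. -/
noncomputable def Δ (N d : ℕ) (s : ℕ → ℕ) (x : ℕ → ℝ)
    (β : (Fin N → Fin (2 * N)) × (Fin N → Fin (2 * N))) : ℝ :=
  Matrix.det (Matrix.of fun k ℓ : Fin N => ker d s x (β.1 k : ℕ) (β.2 ℓ : ℕ))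

/-- The explicit basis function `U_α(x) = Σ_{β ≥_ς α} Δ_β(x)` of Theorem D.2 of the paper. -/
noncomputable def U (N d : ℕ) (s : ℕ → ℕ)
    (α : (Fin N → Fin (2 * N)) × (Fin N → Fin (2 * N))) (x : ℕ → ℝ) : ℝ :=
  ∑ β ∈ (LP N).filter (fun β => geqVal N d s β α), Δ N d s x β

/-- The chamber `𝔛_d` of ordered configurations (using the first `d` coordinates). -/
def chamber (d : ℕ) (x : ℕ → ℝ) : Prop := ∀ i j : ℕ, i < j → j < d → x i < x j

end UST

namespace UST

/-- The first-order operator `ℒ_{−m}^{(j)}` of the paper (0-based `j`), acting on functions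
of `(x_1, …, x_d)`:
`(ℒ_{−m}^{(j)} f)(x) = −Σ_{i≠j} ((x_i − x_j)^{1−m} ∂f/∂x_i
  + (1 − m)(s_i + 1)s_i/2 · (x_i − x_j)^{−m} f(x))`. -/
noncomputable def Lop (d : ℕ) (s : ℕ → ℕ) (j m : ℕ) (f : (ℕ → ℝ) → ℝ) :
    (ℕ → ℝ) → ℝ :=
  fun x =>
    -∑ i ∈ (Finset.range d).erase j,
      ((x i - x j) ^ ((1 : ℤ) - (m : ℤ)) *
          deriv (fun t => f (Function.update x i t)) (x i) +
        (1 - (m : ℝ)) * (((s i + 1) * s i : ℕ) : ℝ) / 2 * (x i - x j) ^ (-(m : ℤ)) * f x)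

end UST

namespace UST

/-- The tuples of `k` positive integers with sum `n`. -/
noncomputable def posTuples (k n : ℕ) : Finset (Fin k → ℕ) :=
  (Finset.Nat.antidiagonalTuple k n).filter (fun m => ∀ i, 1 ≤ m i)

lemma mem_posTuples {k n : ℕ} {m : Fin k → ℕ} :
    m ∈ posTuples k n ↔ ∑ i, m i = n ∧ ∀ i, 1 ≤ m i := by
  simp [posTuples, Finset.Nat.mem_antidiagonalTuple]

lemma sum_posTuples_succ {M : Type*} [AddCommMonoid M] (k n : ℕ) (F : (Fin (k + 1) → ℕ) → M) :
    ∑ m ∈ posTuples (k + 1) n, F m =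
      ∑ a ∈ Finset.Icc 1 n, ∑ t ∈ posTuples k (n - a), F (Fin.cons a t) := by
  rw [Finset.sum_sigma']
  refine Finset.sum_bij' (fun m _ => ⟨m 0, Fin.tail m⟩) (fun p _ => Fin.cons p.1 p.2)
    ?_ ?_ ?_ ?_ ?_
  · intro m hm
    rw [mem_posTuples, Fin.sum_univ_succ] at hm
    simp only [Finset.mem_sigma, Finset.mem_Icc, mem_posTuples, Fin.tail]
    exact ⟨⟨hm.2 0, by omega⟩, by omega, fun i => hm.2 _⟩
  · rintro ⟨a, t⟩ hp
    simp only [Finset.mem_sigma, Finset.mem_Icc, mem_posTuples] at hp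
    rw [mem_posTuples, Fin.sum_univ_succ]
    refine ⟨by simp [hp.2.1]; omega, fun i => ?_⟩
    refine Fin.cases ?_ (fun i => ?_) i
    · simpa using hp.1.1
    · simpa using hp.2.2 i
  · intro m _
    simp
  · rintro ⟨a, t⟩ _
    simp
  · intro m _
    simp

section Recursion

variable {M : Type*} [AddCommGroup M] [Module ℝ M]

/-- The inverse of the factor `n (S - n)`, read as `1` for the empty sum `n = 0`. -/
noncomputable def invWeight (S n : ℕ) : ℝ := if n = 0 then 1 else ((n : ℝ) * ((S : ℝ) - n))⁻¹

/-- The term of the Benoit–Saint-Aubin sum attached to a list of modes, built recursively. -/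
noncomputable def bsaTerm (L : ℕ → M →ₗ[ℝ] M) (v : M) (S : ℕ) : List ℕ → M
  | [] => v
  | a :: t => ((-2 : ℝ) ^ (a - 1) * invWeight S t.sum) • L a (bsaTerm L v S t)

lemma sum_bsaTerm_succ (L : ℕ → M →ₗ[ℝ] M) (v : M) (S n : ℕ) (hn : 1 ≤ n) :
    ∑ k ∈ Finset.range (n + 1), ∑ m ∈ posTuples k n, bsaTerm L v S (List.ofFn m) =
      ∑ a ∈ Finset.Icc 1 n, ((-2 : ℝ) ^ (a - 1) * invWeight S (n - a)) •
        L a (∑ k ∈ Finset.range (n - a + 1), ∑ m ∈ posTuples k (n - a),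
          bsaTerm L v S (List.ofFn m)) := by
  rw [Finset.sum_range_succ']
  have h0 : ∑ m ∈ posTuples 0 n, bsaTerm L v S (List.ofFn m) = 0 := by
    refine Finset.sum_eq_zero fun m hm => ?_
    rw [mem_posTuples] at hm
    simp at hm
    omega
  rw [h0, add_zero]
  simp_rw [sum_posTuples_succ]
  rw [Finset.sum_comm]
  refine Finset.sum_congr rfl fun a ha => ?_
  rw [Finset.mem_Icc] at ha
  rw [map_sum, Finset.smul_sum]
  have hsub : Finset.range (n - a + 1) ⊆ Finset.range n := by
    intro i hi
    simp only [Finset.mem_range] at hi ⊢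
    omega
  rw [← Finset.sum_subset hsub]
  · refine Finset.sum_congr rfl fun k _ => ?_
    rw [map_sum, Finset.smul_sum]
    refine Finset.sum_congr rfl fun t ht => ?_
    rw [mem_posTuples] at ht
    rw [List.ofFn_succ]
    simp only [Fin.cons_zero, Fin.cons_succ, bsaTerm, List.sum_ofFn]
    rw [ht.1]
  · intro k _ hk
    refine Finset.sum_eq_zero fun t ht => ?_
    rw [mem_posTuples] at ht
    exfalso
    have : ∑ i : Fin k, 1 ≤ ∑ i, t i := Finset.sum_le_sum fun i _ => ht.2 i
    simp only [Finset.sum_const, Finset.card_univ, Fintype.card_fin, smul_eq_mul, mul_one] at this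
    simp only [Finset.mem_range] at hk
    omega

lemma sum_bsaTerm_eq (L : ℕ → M →ₗ[ℝ] M) (g : ℕ → M) (S : ℕ)
    (h : ∀ r, 1 ≤ r → r ≤ S →
      ∑ m ∈ Finset.Icc 1 r, (-2 : ℝ) ^ (m - 1) • L m (g (r - m)) =
        ((r : ℝ) * ((S : ℝ) - r)) • g r) (n : ℕ) (hn : n ≤ S) :
    ∑ k ∈ Finset.range (n + 1), ∑ m ∈ posTuples k n, bsaTerm L (g 0) S (List.ofFn m) =
      if n = 0 then g 0 else ((n : ℝ) * ((S : ℝ) - n)) • g n := by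
  induction n using Nat.strong_induction_on with
  | _ n ih =>
    rcases Nat.eq_zero_or_pos n with rfl | hpos
    · have : posTuples 0 0 = {![]} := by
        ext m
        simp [mem_posTuples, Subsingleton.elim m ![]]
      simp [this, bsaTerm]
    · rw [sum_bsaTerm_succ L (g 0) S n hpos, if_neg (by omega), ← h n hpos hn]
      refine Finset.sum_congr rfl fun a ha => ?_
      rw [Finset.mem_Icc] at ha
      rw [ih (n - a) (by omega) (by omega), mul_smul]
      congr 1
      by_cases h0 : n - a = 0
      · simp [h0, invWeight]
      · simp only [h0, if_false, invWeight, map_smul, smul_smul]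
        rw [inv_mul_cancel₀, one_smul]
        have h1 : ((n - a : ℕ) : ℝ) ≠ 0 := by exact_mod_cast h0
        have h2 : ((n - a : ℕ) : ℝ) < S := by exact_mod_cast (by omega : n - a < S)
        exact mul_ne_zero h1 (by linarith)

lemma bsaTerm_ofFn (L : ℕ → M →ₗ[ℝ] M) (v : M) (S k : ℕ) (m : Fin k → ℕ) (hm : ∀ i, 1 ≤ m i) :
    bsaTerm L v S (List.ofFn m) =
      ((-2 : ℝ) ^ (∑ i, m i - k) /
        ∏ l ∈ Finset.Ico 1 k,
          ((∑ i ∈ Finset.univ.filter (fun i : Fin k => l ≤ (i : ℕ)), (m i : ℝ)) *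
            ((S : ℝ) - ∑ i ∈ Finset.univ.filter (fun i : Fin k => l ≤ (i : ℕ)), (m i : ℝ)))) •
        (List.ofFn m).foldr (fun a w => L a w) v := by
  induction k with
  | zero => simp [bsaTerm]
  | succ k ih =>
    rw [List.ofFn_succ]
    simp only [bsaTerm, List.foldr_cons]
    rw [ih (fun i => m i.succ) (fun i => hm _), map_smul, smul_smul]
    congr 1
    have hle : k ≤ ∑ i : Fin k, m i.succ := by
      have : ∑ i : Fin k, 1 ≤ ∑ i : Fin k, m i.succ := Finset.sum_le_sum fun i _ => hm _
      simpa using this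
    have hsuf : ∀ l, (∑ i ∈ Finset.univ.filter (fun i : Fin (k + 1) => l + 1 ≤ (i : ℕ)),
        (m i : ℝ)) = ∑ i ∈ Finset.univ.filter (fun i : Fin k => l ≤ (i : ℕ)),
        (m i.succ : ℝ) := by
      intro l
      rw [Finset.sum_filter, Finset.sum_filter, Fin.sum_univ_succ]
      simp
    have hexp : ∑ i, m i - (k + 1) = (m 0 - 1) + (∑ i : Fin k, m i.succ - k) := by
      rw [Fin.sum_univ_succ]
      have := hm 0
      omega
    rw [hexp, pow_add, List.sum_ofFn]
    have hprod : ∏ l ∈ Finset.Ico 1 (k + 1),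
          ((∑ i ∈ Finset.univ.filter (fun i : Fin (k + 1) => l ≤ (i : ℕ)), (m i : ℝ)) *
            ((S : ℝ) - ∑ i ∈ Finset.univ.filter (fun i : Fin (k + 1) => l ≤ (i : ℕ)), (m i : ℝ)))
        = ∏ l ∈ Finset.range k,
          ((∑ i ∈ Finset.univ.filter (fun i : Fin k => l ≤ (i : ℕ)), (m i.succ : ℝ)) *
            ((S : ℝ) - ∑ i ∈ Finset.univ.filter (fun i : Fin k => l ≤ (i : ℕ)),
              (m i.succ : ℝ))) := by
      rw [Finset.prod_Ico_eq_prod_range]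
      refine Finset.prod_congr (by simp) fun l _ => ?_
      rw [add_comm 1 l, hsuf]
    rw [hprod]
    rcases Nat.eq_zero_or_pos k with rfl | hk
    · simp [invWeight]
    · rw [Finset.range_eq_Ico, Finset.prod_eq_prod_Ico_succ_bot hk]
      have hne : ∑ i : Fin k, m i.succ ≠ 0 := by omega
      simp only [invWeight, hne, if_false]
      simp only [Nat.zero_le, Finset.filter_true, zero_add]
      push_cast
      simp only [div_eq_mul_inv, mul_inv]
      ring

/-- A sequence solving the recursion attached to the modes `L` terminates the
Benoit–Saint-Aubin sum. -/
theorem bsa_sum_eq_zero (L : ℕ → M →ₗ[ℝ] M) (g : ℕ → M) (S : ℕ) (hS : 1 ≤ S) (c : ℝ)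
    (h : ∀ r, 1 ≤ r → r ≤ S →
      ∑ m ∈ Finset.Icc 1 r, (-2 : ℝ) ^ (m - 1) • L m (g (r - m)) =
        ((r : ℝ) * ((S : ℝ) - r)) • g r) :
    ∑ k ∈ Finset.Icc 1 S,
        ∑ m ∈ (Finset.Nat.antidiagonalTuple k S).filter (fun m => ∀ i, 1 ≤ m i),
          ((-2 : ℝ) ^ (S - k) * c /
              ∏ l ∈ Finset.Ico 1 k,
                ((∑ i ∈ Finset.univ.filter (fun i : Fin k => (i : ℕ) < l), (m i : ℝ)) *
                  ∑ i ∈ Finset.univ.filter (fun i : Fin k => l ≤ (i : ℕ)), (m i : ℝ))) •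
            (List.ofFn m).foldr (fun a w => L a w) (g 0) = 0 := by
  have key := sum_bsaTerm_eq L g S h S le_rfl
  rw [if_neg (by omega), sub_self, mul_zero, zero_smul, Finset.sum_range_succ'] at key
  have h0 : ∑ m ∈ posTuples 0 S, bsaTerm L (g 0) S (List.ofFn m) = 0 := by
    refine Finset.sum_eq_zero fun m hm => ?_
    rw [mem_posTuples] at hm
    simp at hm
    omega
  rw [h0, add_zero] at key
  refine Eq.trans ?_ ((congrArg (fun v => c • v) key).trans (smul_zero c))
  rw [Finset.smul_sum, ← Finset.Ico_add_one_right_eq_Icc, Finset.sum_Ico_eq_sum_range]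
  refine Finset.sum_congr (by simp) fun k _ => ?_
  rw [Finset.smul_sum, add_comm 1 k]
  refine Finset.sum_congr rfl fun m hm => ?_
  have hm' := mem_posTuples.1 hm
  rw [bsaTerm_ofFn L (g 0) S (k + 1) m hm'.2, smul_smul, hm'.1]
  congr 1
  have : ∀ l, (∑ i ∈ Finset.univ.filter (fun i : Fin (k + 1) => (i : ℕ) < l), (m i : ℝ)) =
      (S : ℝ) - ∑ i ∈ Finset.univ.filter (fun i : Fin (k + 1) => l ≤ (i : ℕ)), (m i : ℝ) := by
    intro l
    rw [eq_sub_iff_add_eq, ← hm'.1]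
    push_cast
    rw [← Finset.sum_filter_add_sum_filter_not Finset.univ
      (fun i : Fin (k + 1) => (i : ℕ) < l) (fun i => (m i : ℝ))]
    simp only [not_lt]
  simp_rw [this]
  rw [mul_comm _ c, mul_div_assoc]
  congr 2
  exact Finset.prod_congr rfl fun l _ => mul_comm _ _

end Recursion

open PowerSeries

section Modes

variable {M : Type*} [AddCommGroup M] [Module ℝ M] {s : ℕ}

/-- The pairing of a tuple of power series with a function `w` of `s` mode indices,
restricted to total degree `n`. -/
noncomputable def modeSum (w : (Fin s → ℕ) → M) (n : ℕ) :
    MultilinearMap ℝ (fun _ : Fin s => ℝ⟦X⟧) M :=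
  ∑ b ∈ Finset.piAntidiag Finset.univ n,
    ((MultilinearMap.mkPiAlgebra ℝ (Fin s) ℝ).compLinearMap
      (fun i => PowerSeries.coeff (R := ℝ) (b i))).smulRight (w b)

lemma modeSum_apply (w : (Fin s → ℕ) → M) (n : ℕ) (h : Fin s → ℝ⟦X⟧) :
    modeSum w n h = ∑ b ∈ Finset.piAntidiag Finset.univ n,
      (∏ i, coeff (b i) (h i)) • w b := by
  simp [modeSum]

lemma coeff_X_mul_derivative (f : ℝ⟦X⟧) (b : ℕ) :
    coeff b (X * derivative ℝ f) = b * coeff b f := by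
  cases b with
  | zero => simp
  | succ b => rw [coeff_succ_X_mul, coeff_derivative]; push_cast; ring

lemma prod_coeff_update (h : Fin s → ℝ⟦X⟧) (i : Fin s) (f : ℝ⟦X⟧) (b : Fin s → ℕ) :
    ∏ k, coeff (b k) (Function.update h i f k) =
      coeff (b i) f * ∏ k ∈ Finset.univ.erase i, coeff (b k) (h k) := by
  rw [← Finset.mul_prod_erase _ _ (Finset.mem_univ i), Function.update_self]
  congr 1
  refine Finset.prod_congr rfl fun k hk => ?_
  rw [Function.update_of_ne (Finset.ne_of_mem_erase hk)]

/-- Shifting one mode index by `m` corresponds to multiplying one power series by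
`X ^ m` after applying the Euler operator. -/
lemma sum_shift_eq (w : (Fin s → ℕ) → M) (n m : ℕ) (h : Fin s → ℝ⟦X⟧) :
    ∑ b ∈ Finset.piAntidiag Finset.univ n, (∏ i, coeff (b i) (h i)) •
        ∑ i, (b i : ℝ) • w (Function.update b i (b i + m)) =
      ∑ i, modeSum w (n + m) (Function.update h i (X ^ m * (X * derivative ℝ (h i)))) := by
  simp_rw [Finset.smul_sum, modeSum_apply]
  rw [Finset.sum_comm]
  refine Finset.sum_congr rfl fun i _ => ?_
  refine Finset.sum_bij_ne_zero (fun b _ _ => Function.update b i (b i + m)) ?_ ?_ ?_ ?_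
  · intro b hb _
    simp only [Finset.mem_piAntidiag, Finset.mem_univ, implies_true, and_true] at hb ⊢
    rw [← hb, ← Finset.add_sum_erase _ _ (Finset.mem_univ i), Function.update_self,
      ← Finset.add_sum_erase _ b (Finset.mem_univ i)]
    rw [Finset.sum_congr rfl (fun k hk => Function.update_of_ne (Finset.ne_of_mem_erase hk) _ _)]
    ring
  · intro b _ _ b' _ _ he
    funext k
    have := congrFun he k
    by_cases hk : k = i
    · subst hk; simpa using this
    · simpa [hk] using this
  · intro b hb hne
    have hm : m ≤ b i := by
      by_contra hlt
      apply hne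
      rw [prod_coeff_update, coeff_X_pow_mul', if_neg hlt, zero_mul, zero_smul]
    simp only [Finset.mem_piAntidiag, Finset.mem_univ, implies_true, and_true] at hb
    have hup : Function.update (Function.update b i (b i - m)) i
        (Function.update b i (b i - m) i + m) = b := by
      funext k
      by_cases hk : k = i
      · subst hk; simp [hm]
      · simp [hk]
    refine ⟨Function.update b i (b i - m), ?_, ?_, hup⟩
    · simp only [Finset.mem_piAntidiag, Finset.mem_univ, implies_true, and_true]
      rw [← Finset.add_sum_erase _ _ (Finset.mem_univ i), Function.update_self]
      rw [← Finset.add_sum_erase _ b (Finset.mem_univ i)] at hb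
      rw [Finset.sum_congr rfl
        (fun k hk => Function.update_of_ne (Finset.ne_of_mem_erase hk) _ _)]
      omega
    · rw [hup, smul_smul, Function.update_self]
      rw [prod_coeff_update, coeff_X_pow_mul', if_pos hm, coeff_X_mul_derivative] at hne
      rw [← Finset.mul_prod_erase _ _ (Finset.mem_univ i), Function.update_self]
      rw [Finset.prod_congr rfl (fun k hk => by
        rw [Function.update_of_ne (Finset.ne_of_mem_erase hk)])]
      convert hne using 2
      ring
  · intro b _ _
    rw [smul_smul, prod_coeff_update, coeff_X_pow_mul', Function.update_self,
      if_pos (by omega), Nat.add_sub_cancel, coeff_X_mul_derivative]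
    congr 1
    rw [← Finset.mul_prod_erase _ _ (Finset.mem_univ i)]
    rw [Finset.prod_congr (f := fun k => coeff (Function.update b i (b i + m) k) (h k))
      (g := fun k => coeff (b k) (h k)) rfl (fun k hk => by
        rw [Function.update_of_ne (Finset.ne_of_mem_erase hk)])]
    ring

lemma nat_smul_modeSum (w : (Fin s → ℕ) → M) (n : ℕ) (h : Fin s → ℝ⟦X⟧) :
    (n : ℝ) • modeSum w n h =
      ∑ i, modeSum w n (Function.update h i (X * derivative ℝ (h i))) := by
  have := sum_shift_eq w n 0 h
  simp only [add_zero, pow_zero, one_mul] at this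
  rw [← this, modeSum_apply, Finset.smul_sum]
  refine Finset.sum_congr rfl fun b hb => ?_
  simp only [Finset.mem_piAntidiag, Finset.mem_univ, implies_true, and_true] at hb
  simp only [Function.update_eq_self]
  rw [← Finset.sum_smul, ← hb, smul_smul, smul_smul]
  push_cast
  rw [mul_comm]

lemma modeSum_eq_zero_of_eq (w : (Fin s → ℕ) → M)
    (hw : ∀ b i k, i ≠ k → w (b ∘ Equiv.swap i k) = -w b) (n : ℕ) (h : Fin s → ℝ⟦X⟧)
    (i k : Fin s) (hik : i ≠ k) (hh : h i = h k) : modeSum w n h = 0 := by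
  suffices hneg : modeSum w n h = -modeSum w n h by
    have h2 : (2 : ℝ) • modeSum w n h = 0 := by
      rw [two_smul]
      nth_rewrite 2 [hneg]
      exact add_neg_cancel _
    exact (smul_eq_zero.1 h2).resolve_left two_ne_zero
  conv_lhs => rw [modeSum_apply]
  rw [modeSum_apply, ← Finset.sum_neg_distrib]
  have hinv : ∀ b : Fin s → ℕ, (b ∘ Equiv.swap i k) ∘ Equiv.swap i k = b := by
    intro b
    funext t
    simp
  have hsum : ∀ b : Fin s → ℕ, ∑ t, (b ∘ Equiv.swap i k) t = ∑ t, b t := fun b =>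
    Equiv.sum_comp (Equiv.swap i k) b
  refine Finset.sum_bij' (fun b _ => b ∘ Equiv.swap i k) (fun b _ => b ∘ Equiv.swap i k)
    ?_ ?_ (fun b _ => hinv b) (fun b _ => hinv b) ?_
  · intro b hb
    simp only [Finset.mem_piAntidiag, Finset.mem_univ, implies_true, and_true] at hb ⊢
    rw [hsum, hb]
  · intro b hb
    simp only [Finset.mem_piAntidiag, Finset.mem_univ, implies_true, and_true] at hb ⊢
    rw [hsum, hb]
  · intro b _
    rw [hw b i k hik, smul_neg, neg_neg]
    congr 1
    rw [← Equiv.prod_comp (Equiv.swap i k)]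
    refine Finset.prod_congr rfl fun t _ => ?_
    simp only [Function.comp]
    congr 1
    rcases eq_or_ne t i with rfl | h1
    · simp [hh]
    · rcases eq_or_ne t k with rfl | h2
      · simp [hh]
      · rw [Equiv.swap_apply_of_ne_of_ne h1 h2]

/-- The lowest total degree `1 + 2 + ⋯ + s` of `s` distinct positive modes. -/
def minLevel (s : ℕ) : ℕ := ∑ i : Fin s, ((i : ℕ) + 1)

/-- The pairing at level `r` above the lowest one, the `i`-th power series being shifted
by `i + 1`. -/
noncomputable def levelSum (w : (Fin s → ℕ) → M) (r : ℕ) :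
    MultilinearMap ℝ (fun _ : Fin s => ℝ⟦X⟧) M :=
  (modeSum w (minLevel s + r)).compLinearMap
    (fun i => LinearMap.mulLeft ℝ (X ^ ((i : ℕ) + 1) : ℝ⟦X⟧))

lemma levelSum_apply (w : (Fin s → ℕ) → M) (r : ℕ) (h : Fin s → ℝ⟦X⟧) :
    levelSum w r h = modeSum w (minLevel s + r) (fun i => X ^ ((i : ℕ) + 1) * h i) := by
  simp [levelSum]

lemma shifted_update (h : Fin s → ℝ⟦X⟧) (i : Fin s) (f : ℝ⟦X⟧) :
    (fun k : Fin s => X ^ ((k : ℕ) + 1) * Function.update h i f k) =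
      Function.update (fun k : Fin s => X ^ ((k : ℕ) + 1) * h k) i
        (X ^ ((i : ℕ) + 1) * f) := by
  funext k
  rcases eq_or_ne k i with rfl | hk
  · simp
  · simp [hk]

lemma X_mul_derivative_shifted (i : ℕ) (f : ℝ⟦X⟧) :
    X * derivative ℝ (X ^ (i + 1) * f) =
      X ^ (i + 1) * (((i : ℝ) + 1) • f + X * derivative ℝ f) := by
  ext n
  rw [coeff_X_mul_derivative, coeff_X_pow_mul', coeff_X_pow_mul']
  split_ifs with hn
  · rw [map_add, coeff_X_mul_derivative, coeff_smul, smul_eq_mul, Nat.cast_sub hn]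
    push_cast
    ring
  · simp

lemma nat_smul_levelSum (w : (Fin s → ℕ) → M) (r : ℕ) (h : Fin s → ℝ⟦X⟧) :
    (r : ℝ) • levelSum w r h =
      ∑ i, levelSum w r (Function.update h i (X * derivative ℝ (h i))) := by
  have h1 := nat_smul_modeSum w (minLevel s + r) (fun i => X ^ ((i : ℕ) + 1) * h i)
  simp_rw [X_mul_derivative_shifted, ← shifted_update, ← levelSum_apply] at h1
  simp_rw [(levelSum w r).map_update_add, (levelSum w r).map_update_smul,
    Function.update_eq_self, Finset.sum_add_distrib, ← Finset.sum_smul] at h1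
  have h2 : ((minLevel s + r : ℕ) : ℝ) = ∑ i : Fin s, (((i : ℕ) : ℝ) + 1) + r := by
    simp [minLevel]
  rw [h2, add_smul] at h1
  exact add_left_cancel h1

lemma levelSum_eq_zero_of_dvd (w : (Fin s → ℕ) → M) (r : ℕ) (h : Fin s → ℝ⟦X⟧) (i : Fin s)
    (hi : X ^ (r + 1) ∣ h i) : levelSum w r h = 0 := by
  rw [levelSum_apply, modeSum_apply]
  refine Finset.sum_eq_zero fun b hb => ?_
  simp only [Finset.mem_piAntidiag, Finset.mem_univ, implies_true, and_true] at hb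
  obtain ⟨f, hf⟩ := hi
  by_cases hall : ∀ k : Fin s, (k : ℕ) + 1 + (if k = i then r + 1 else 0) ≤ b k
  · exfalso
    have := Finset.sum_le_sum fun k (_ : k ∈ Finset.univ) => hall k
    rw [Finset.sum_add_distrib, hb, Finset.sum_ite_eq' Finset.univ i] at this
    simp only [Finset.mem_univ, if_true] at this
    rw [← minLevel] at this
    omega
  · push Not at hall
    obtain ⟨k, hk⟩ := hall
    rw [Finset.prod_eq_zero (Finset.mem_univ k), zero_smul]
    by_cases hki : k = i
    · subst hki
      rw [if_pos rfl] at hk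
      rw [hf, ← mul_assoc, ← pow_add, coeff_X_pow_mul', if_neg (by omega)]
    · rw [if_neg hki] at hk
      rw [coeff_X_pow_mul', if_neg (by omega)]

section Alternating

variable (w : (Fin s → ℕ) → M) (hw : ∀ b i k, i ≠ k → w (b ∘ Equiv.swap i k) = -w b)
include hw

lemma levelSum_eq_zero_of_adjacent (r : ℕ) (h : Fin s → ℝ⟦X⟧) (i k : Fin s)
    (hik : (k : ℕ) = i + 1) (hh : h i = X * h k) : levelSum w r h = 0 := by
  rw [levelSum_apply]
  refine modeSum_eq_zero_of_eq w hw _ _ i k (fun e => by subst e; omega) ?_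
  rw [hh, hik]
  ring

lemma levelSum_eq_zero_of_interval (r : ℕ) (Q : ℝ⟦X⟧) (n : ℕ) :
    ∀ (h : Fin s → ℝ⟦X⟧) (i k : Fin s), (k : ℕ) = i + n + 1 → h i = X * Q → h k = Q →
      (∀ t, i < t → t < k → h t = Q + (2 : ℝ) • (X * Q)) → levelSum w r h = 0 := by
  induction n with
  | zero =>
    intro h i k hik hi hk _
    exact levelSum_eq_zero_of_adjacent w hw r h i k (by omega) (by rw [hi, hk])
  | succ n ih =>
    intro h i k hik hi hk hmid
    let t : Fin s := ⟨i + 1, by have := k.2; omega⟩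
    have hit : i < t := Fin.lt_def.2 (by simp [t])
    have htk : t < k := Fin.lt_def.2 (by simp only [t]; omega)
    have hup : h = Function.update h t (Q + (2 : ℝ) • (X * Q)) := by
      rw [← hmid t hit htk, Function.update_eq_self]
    rw [hup, (levelSum w r).map_update_add, (levelSum w r).map_update_smul]
    rw [levelSum_eq_zero_of_adjacent w hw r _ i t (by simp [t])
      (by rw [Function.update_self, Function.update_of_ne hit.ne, hi])]
    rw [ih _ t k (by simp only [t]; omega) (by rw [Function.update_self])
      (by rw [Function.update_of_ne htk.ne', hk]), smul_zero, add_zero]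
    intro u htu huk
    rw [Function.update_of_ne htu.ne', hmid u (hit.trans htu) huk]

/-- The quadratic relation satisfied by the pairing with the constant tuple
`R = (1 + 2 X) Q`, where `(1 + 2 X) Q' = - Q`. -/
theorem levelSum_recursion (r : ℕ) (Q R : ℝ⟦X⟧) (hR : R = Q + (2 : ℝ) • (X * Q))
    (hQ : (1 + 2 * X) * derivative ℝ Q = -Q) :
    ∑ m ∈ Finset.Icc 1 r, (-2 : ℝ) ^ (m - 1) •
        ∑ i : Fin s, levelSum w r (Function.update (fun _ => R) i
          (X ^ m * ((((i : ℕ) : ℝ) + 1) • R + X * derivative ℝ R))) =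
      ((r : ℝ) * (((s + 1 : ℕ) : ℝ) - r)) • levelSum w r (fun _ => R) := by
  set P : ℝ⟦X⟧ := 1 + 2 * X with hP
  have hP0 : constantCoeff P ≠ 0 := by simp [hP]
  have hPinv : P * P⁻¹ = 1 := PowerSeries.mul_inv_cancel P hP0
  have hRP : R = P * Q := by
    rw [hR, hP, PowerSeries.smul_eq_C_mul]
    have : (C (2 : ℝ) : ℝ⟦X⟧) = 2 := map_ofNat C 2
    rw [this]
    ring
  have hdR : derivative ℝ R = Q := by
    have h2 : derivative ℝ P = 2 := by
      rw [hP]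
      simp [Derivation.leibniz]
      have : derivative ℝ (2 : ℝ⟦X⟧) = 0 := by
        have := (derivative ℝ).map_natCast 2
        simpa using this
      exact this
    rw [hRP, Derivation.leibniz, smul_eq_mul, smul_eq_mul, hQ, h2]
    ring
  set Y : ℝ⟦X⟧ := X * Q with hY
  set Z : ℝ⟦X⟧ := X ^ 2 * P⁻¹ * Q with hZ
  have hdQ : derivative ℝ Q = -(P⁻¹ * Q) := by
    linear_combination (P⁻¹) * hQ - (derivative ℝ Q) * hPinv
  have hθY : X * derivative ℝ Y = Y - Z := by
    rw [hY, Derivation.leibniz, hdQ, smul_eq_mul, smul_eq_mul, derivative_X, hZ]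
    ring
  have hgeom : ∀ r : ℕ, ∃ f : ℝ⟦X⟧,
      ∑ m ∈ Finset.Icc 1 r, (-2 : ℝ) ^ (m - 1) • (X : ℝ⟦X⟧) ^ m =
        X * P⁻¹ + X ^ (r + 1) * f := by
    intro r
    induction r with
    | zero => exact ⟨-P⁻¹, by simp⟩
    | succ r ih =>
      obtain ⟨f, hf⟩ := ih
      have hfac : P * (∑ m ∈ Finset.Icc 1 r, (-2 : ℝ) ^ (m - 1) • (X : ℝ⟦X⟧) ^ m) =
          X - (-2 : ℝ) ^ r • X ^ (r + 1) := by
        clear hf f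
        induction r with
        | zero => simp
        | succ r ih =>
          rw [Finset.sum_Icc_succ_top (by omega), mul_add, ih, hP]
          simp only [Nat.add_sub_cancel, PowerSeries.smul_eq_C_mul, map_pow, map_neg]
          have : (C (2 : ℝ) : ℝ⟦X⟧) = 2 := map_ofNat C 2
          rw [this]
          ring
      refine ⟨-(P⁻¹ * C ((-2 : ℝ) ^ (r + 1))), ?_⟩
      have hfac' : P * (∑ m ∈ Finset.Icc 1 (r + 1), (-2 : ℝ) ^ (m - 1) • (X : ℝ⟦X⟧) ^ m) =
          X - (-2 : ℝ) ^ (r + 1) • X ^ (r + 2) := by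
        rw [Finset.sum_Icc_succ_top (by omega), mul_add, hfac, hP]
        simp only [Nat.add_sub_cancel, PowerSeries.smul_eq_C_mul, map_pow, map_neg]
        have : (C (2 : ℝ) : ℝ⟦X⟧) = 2 := map_ofNat C 2
        rw [this]
        ring
      rw [PowerSeries.smul_eq_C_mul] at hfac'
      linear_combination P⁻¹ * hfac' -
        (∑ m ∈ Finset.Icc 1 (r + 1), (-2 : ℝ) ^ (m - 1) • (X : ℝ⟦X⟧) ^ m) * hPinv
  let φ : Fin s → ℝ⟦X⟧ → M := fun i f => levelSum w r (Function.update (fun _ => R) i f)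
  let D : Fin s → Fin s → M := fun i k =>
    levelSum w r (Function.update (Function.update (fun _ => R) i Y) k Y)
  have hlhs : ∀ i : Fin s, ∑ m ∈ Finset.Icc 1 r, (-2 : ℝ) ^ (m - 1) •
      levelSum w r (Function.update (fun _ => R) i
          (X ^ m * ((((i : ℕ) : ℝ) + 1) • R + X * derivative ℝ R))) =
      (((i : ℕ) : ℝ) + 1) • φ i Y + φ i Z := by
    intro i
    obtain ⟨f, hf⟩ := hgeom r
    simp_rw [← (levelSum w r).map_update_smul, ← MultilinearMap.map_update_sum,
      ← smul_mul_assoc, ← Finset.sum_mul]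
    have hz : levelSum w r (Function.update (fun _ => R) i
        (X ^ (r + 1) * f * ((((i : ℕ) : ℝ) + 1) • R + X * derivative ℝ R))) = 0 :=
      levelSum_eq_zero_of_dvd w r _ i (by
        rw [Function.update_self, mul_assoc]; exact Dvd.intro _ rfl)
    rw [hf, add_mul, (levelSum w r).map_update_add, hz, add_zero]
    have : X * P⁻¹ * ((((i : ℕ) : ℝ) + 1) • R + X * derivative ℝ R) =
        (((i : ℕ) : ℝ) + 1) • Y + Z := by
      rw [hdR, hRP, hY, hZ, PowerSeries.smul_eq_C_mul, PowerSeries.smul_eq_C_mul]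
      linear_combination (X * C (((i : ℕ) : ℝ) + 1) * Q) * hPinv
    rw [this, (levelSum w r).map_update_add, (levelSum w r).map_update_smul]
  have h1 : (r : ℝ) • levelSum w r (fun _ => R) = ∑ i, φ i Y := by
    rw [nat_smul_levelSum]
    simp only [hdR, φ, hY]
  have h2 : ∀ i, (r : ℝ) • φ i Y = φ i Y - φ i Z + ∑ k ∈ Finset.univ.erase i, D i k := by
    intro i
    simp only [φ]
    rw [nat_smul_levelSum, ← Finset.add_sum_erase _ _ (Finset.mem_univ i)]
    congr 1
    · rw [Function.update_self, Function.update_idem, hθY, (levelSum w r).map_update_sub]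
    · refine Finset.sum_congr rfl fun k hk => ?_
      rw [Function.update_of_ne (Finset.ne_of_mem_erase hk), hdR]
  have h3 : ∀ i k : Fin s, i < k → (2 : ℝ) • D i k = φ i Y := by
    intro i k hik
    have hup : Function.update (fun _ => R) i Y =
        Function.update (Function.update (fun _ => R) i Y) k (Q + (2 : ℝ) • Y) := by
      rw [← hR]
      funext t
      rcases eq_or_ne t k with rfl | ht
      · simp [hik.ne']
      · simp [ht]
    have h4 : levelSum w r
        (Function.update (Function.update (fun _ => R) i Y) k Q) = 0 := by
      refine levelSum_eq_zero_of_interval w hw r Q ((k : ℕ) - i - 1) _ i k ?_ ?_ ?_ ?_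
      · have := Fin.lt_def.1 hik
        omega
      · rw [Function.update_of_ne hik.ne, Function.update_self]
      · rw [Function.update_self]
      · intro t h1 h2
        rw [Function.update_of_ne h2.ne, Function.update_of_ne h1.ne', hR]
    simp only [φ]
    rw [hup, (levelSum w r).map_update_add, (levelSum w r).map_update_smul, h4, zero_add]
  have h5 : ∀ i k : Fin s, i ≠ k → D i k = D k i := by
    intro i k hik
    simp only [D]
    rw [Function.update_comm hik]
  have h6 : ∑ i, ∑ k ∈ Finset.univ.erase i, D i k =
      ∑ i : Fin s, ((s : ℝ) - 1 - (i : ℕ)) • φ i Y := by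
    have e1 : ∀ i : Fin s, ∑ k ∈ Finset.univ.erase i, D i k =
        ∑ k ∈ Finset.univ.filter (fun k => i < k), D i k +
          ∑ k ∈ Finset.univ.filter (fun k => k < i), D i k := by
      intro i
      rw [← Finset.sum_union]
      · refine Finset.sum_congr ?_ fun _ _ => rfl
        ext k
        simp only [Finset.mem_erase, Finset.mem_univ, and_true, Finset.mem_union,
          Finset.mem_filter, true_and]
        rw [ne_iff_lt_or_gt]
        exact or_comm
      · rw [Finset.disjoint_filter]
        intro k _ h1 h2
        exact absurd (h1.trans h2) (lt_irrefl _)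
    simp_rw [e1, Finset.sum_add_distrib]
    have e2 : ∑ i, ∑ k ∈ Finset.univ.filter (fun k => k < i), D i k =
        ∑ i, ∑ k ∈ Finset.univ.filter (fun k => i < k), D i k := by
      simp_rw [Finset.sum_filter]
      rw [Finset.sum_comm]
      refine Finset.sum_congr rfl fun i _ => Finset.sum_congr rfl fun k _ => ?_
      split_ifs with h
      · exact h5 _ _ h.ne'
      · rfl
    rw [e2, ← Finset.sum_add_distrib]
    refine Finset.sum_congr rfl fun i _ => ?_
    rw [← Finset.sum_add_distrib]
    rw [Finset.sum_congr rfl (fun k hk => by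
      rw [← two_smul ℝ, h3 i k (Finset.mem_filter.1 hk).2]), Finset.sum_const,
      ← Nat.cast_smul_eq_nsmul ℝ]
    congr 1
    have : (Finset.univ.filter (fun k => i < k)).card = s - 1 - i := by
      rw [show Finset.univ.filter (fun k => i < k) = Finset.Ioi i by ext; simp]
      exact Fin.card_Ioi i
    rw [this, Nat.cast_sub (by have := i.2; omega), Nat.cast_sub (by have := i.2; omega)]
    push_cast
    ring
  simp_rw [Finset.smul_sum]
  rw [Finset.sum_comm, Finset.sum_congr rfl (fun i _ => hlhs i), mul_comm, mul_smul, h1]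
  have h7 : (r : ℝ) • ∑ i, φ i Y = ∑ i, φ i Y - ∑ i, φ i Z +
      ∑ i : Fin s, ((s : ℝ) - 1 - (i : ℕ)) • φ i Y := by
    rw [Finset.smul_sum, Finset.sum_congr rfl (fun i _ => h2 i), Finset.sum_add_distrib, h6,
      Finset.sum_sub_distrib]
  rw [sub_smul, h7, Finset.smul_sum, ← Finset.sum_sub_distrib, ← Finset.sum_add_distrib,
    ← Finset.sum_sub_distrib]
  refine Finset.sum_congr rfl fun i _ => ?_
  push_cast
  module

end Alternating

end Modes

/-- The coefficients of `(1 + 2 X) ^ (-1/2)`. -/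
noncomputable def invSqrtCoeff : ℕ → ℝ
  | 0 => 1
  | n + 1 => -(2 * n + 1) / (n + 1) * invSqrtCoeff n

/-- The power series `(1 + 2 X) ^ (-1/2)`. -/
noncomputable def invSqrtSeries : ℝ⟦X⟧ := PowerSeries.mk invSqrtCoeff

lemma derivative_invSqrtSeries :
    (1 + 2 * X) * derivative ℝ invSqrtSeries = -invSqrtSeries := by
  ext n
  have h2 : ∀ f : ℝ⟦X⟧, (2 : ℝ⟦X⟧) * X * f = (2 : ℝ) • (X * f) := by
    intro f
    rw [PowerSeries.smul_eq_C_mul]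
    have : (C (2 : ℝ) : ℝ⟦X⟧) = 2 := map_ofNat C 2
    rw [this, mul_assoc]
  rw [add_mul, one_mul, h2, map_add, coeff_smul, coeff_X_mul_derivative, coeff_derivative,
    map_neg, invSqrtSeries, coeff_mk, coeff_mk, invSqrtCoeff, smul_eq_mul]
  have : (n : ℝ) + 1 ≠ 0 := by positivity
  field_simp
  ring

lemma derivation_prod {A B ι : Type*} [CommRing A] [CommRing B] [Algebra B A]
    [DecidableEq ι] (D : Derivation B A A)
    (S : Finset ι) (g : ι → A) :
    D (∏ k ∈ S, g k) = ∑ k ∈ S, D (g k) * ∏ k' ∈ S.erase k, g k' := by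
  induction S using Finset.induction_on with
  | empty => simp
  | insert a S ha ih =>
    rw [Finset.prod_insert ha, D.leibniz, ih, Finset.sum_insert ha, Finset.erase_insert ha,
      smul_eq_mul, smul_eq_mul, Finset.mul_sum, add_comm, mul_comm (∏ k ∈ S, g k)]
    congr 1
    refine Finset.sum_congr rfl fun k hk => ?_
    have hka : a ≠ k := fun h => ha (h ▸ hk)
    rw [Finset.erase_insert_of_ne hka,
      Finset.prod_insert (fun h => ha (Finset.mem_of_mem_erase h))]
    ring

section PairProduct

variable {A V K : Type*} [CommRing A] [AddCommGroup V] [Module A V] [Fintype K] [DecidableEq K]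

lemma prod_update_inl (ω : V →ₗ[A] V →ₗ[A] A) (f : K ⊕ K → V) (k₀ : K) (u : V) :
    ∏ k, ω (Function.update f (Sum.inl k₀) u (Sum.inl k))
        (Function.update f (Sum.inl k₀) u (Sum.inr k)) =
      ω u (f (Sum.inr k₀)) *
        ∏ k ∈ Finset.univ.erase k₀, ω (f (Sum.inl k)) (f (Sum.inr k)) := by
  rw [← Finset.mul_prod_erase _ _ (Finset.mem_univ k₀), Function.update_self,
    Function.update_of_ne Sum.inr_ne_inl]
  congr 1
  refine Finset.prod_congr rfl fun k hk => ?_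
  rw [Function.update_of_ne Sum.inr_ne_inl,
    Function.update_of_ne (fun h => Finset.ne_of_mem_erase hk (Sum.inl_injective h))]

lemma prod_update_inr (ω : V →ₗ[A] V →ₗ[A] A) (f : K ⊕ K → V) (k₀ : K) (u : V) :
    ∏ k, ω (Function.update f (Sum.inr k₀) u (Sum.inl k))
        (Function.update f (Sum.inr k₀) u (Sum.inr k)) =
      ω (f (Sum.inl k₀)) u *
        ∏ k ∈ Finset.univ.erase k₀, ω (f (Sum.inl k)) (f (Sum.inr k)) := by
  rw [← Finset.mul_prod_erase _ _ (Finset.mem_univ k₀), Function.update_self,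
    Function.update_of_ne Sum.inl_ne_inr]
  congr 1
  refine Finset.prod_congr rfl fun k hk => ?_
  rw [Function.update_of_ne Sum.inl_ne_inr,
    Function.update_of_ne (fun h => Finset.ne_of_mem_erase hk (Sum.inr_injective h))]

variable (K) in
/-- The product of the values of a bilinear form over pairs of arguments. -/
noncomputable def pairProd (ω : V →ₗ[A] V →ₗ[A] A) :
    MultilinearMap A (fun _ : K ⊕ K => V) A :=
  MultilinearMap.mk' (fun f => ∏ k, ω (f (Sum.inl k)) (f (Sum.inr k)))
    (fun f t u v => by
      rcases t with k | k
      · simp only [prod_update_inl, map_add, LinearMap.add_apply, add_mul]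
      · simp only [prod_update_inr, map_add, add_mul])
    (fun f t c u => by
      rcases t with k | k
      · simp only [prod_update_inl, map_smul, LinearMap.smul_apply, smul_mul_assoc]
      · simp only [prod_update_inr, map_smul, smul_mul_assoc])

lemma pairProd_apply (ω : V →ₗ[A] V →ₗ[A] A) (f : K ⊕ K → V) :
    pairProd K ω f = ∏ k, ω (f (Sum.inl k)) (f (Sum.inr k)) := rfl

lemma sum_pairProd_update (ω : V →ₗ[A] V →ₗ[A] A) (T : V → V) (f : K ⊕ K → V) :
    ∑ t, pairProd K ω (Function.update f t (T (f t))) =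
      ∑ k, (ω (T (f (Sum.inl k))) (f (Sum.inr k)) + ω (f (Sum.inl k)) (T (f (Sum.inr k)))) *
        ∏ k' ∈ Finset.univ.erase k, ω (f (Sum.inl k')) (f (Sum.inr k')) := by
  simp only [pairProd_apply, Fintype.sum_sum_type, prod_update_inl, prod_update_inr, add_mul,
    Finset.sum_add_distrib]

variable (K) in
/-- The alternating sum of the products over pairs: up to normalization, the Pfaffian of the
skew part of the Gram matrix. -/
noncomputable def pairAlt (ω : V →ₗ[A] V →ₗ[A] A) : V [⋀^(K ⊕ K)]→ₗ[A] A :=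
  MultilinearMap.alternatization (pairProd K ω)

lemma pairAlt_apply (ω : V →ₗ[A] V →ₗ[A] A) (f : K ⊕ K → V) :
    pairAlt K ω f = ∑ σ : Equiv.Perm (K ⊕ K), Equiv.Perm.sign σ •
      ∏ k, ω (f (σ (Sum.inl k))) (f (σ (Sum.inr k))) := by
  rw [pairAlt, MultilinearMap.alternatization_apply]
  rfl

lemma sum_pairAlt_update (ω : V →ₗ[A] V →ₗ[A] A) (T : V → V) (f : K ⊕ K → V) :
    ∑ t, pairAlt K ω (Function.update f t (T (f t))) =
      ∑ σ : Equiv.Perm (K ⊕ K), Equiv.Perm.sign σ •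
        ∑ k, (ω (T (f (σ (Sum.inl k)))) (f (σ (Sum.inr k))) +
            ω (f (σ (Sum.inl k))) (T (f (σ (Sum.inr k))))) *
          ∏ k' ∈ Finset.univ.erase k, ω (f (σ (Sum.inl k'))) (f (σ (Sum.inr k'))) := by
  simp only [pairAlt_apply]
  rw [Finset.sum_comm]
  refine Finset.sum_congr rfl fun σ _ => ?_
  rw [← Finset.smul_sum]
  congr 1
  have h := sum_pairProd_update ω T (fun t => f (σ t))
  rw [← h, ← Equiv.sum_comp σ]
  refine Finset.sum_congr rfl fun t _ => ?_
  rw [pairProd_apply]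
  have hup : ∀ t', Function.update f (σ t) (T (f (σ t))) (σ t') =
      Function.update (fun t => f (σ t)) t (T (f (σ t))) t' := by
    intro t'
    rcases eq_or_ne t' t with rfl | ht
    · simp
    · rw [Function.update_of_ne ht, Function.update_of_ne (fun h => ht (σ.injective h))]
  simp only [hup]

/-- An infinitesimal isometry of the bilinear form annihilates the alternating pairing. -/
lemma sum_pairAlt_update_eq_zero (ω : V →ₗ[A] V →ₗ[A] A) (T : V → V) (f : K ⊕ K → V)
    (hT : ∀ u v, ω (T u) v + ω u (T v) = 0) :
    ∑ t, pairAlt K ω (Function.update f t (T (f t))) = 0 := by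
  rw [sum_pairAlt_update]
  simp [hT]

/-- The derivative of the alternating pairing, when differentiating the bilinear form
amounts to applying `T` to either argument. -/
lemma derivation_pairAlt {B : Type*} [CommRing B] [Algebra B A] (D : Derivation B A A)
    (ω : V →ₗ[A] V →ₗ[A] A) (T : V → V) (f : K ⊕ K → V)
    (hT : ∀ t t', D (ω (f t) (f t')) = ω (T (f t)) (f t') + ω (f t) (T (f t'))) :
    D (pairAlt K ω f) = ∑ t, pairAlt K ω (Function.update f t (T (f t))) := by
  rw [sum_pairAlt_update, pairAlt_apply, map_sum]
  refine Finset.sum_congr rfl fun σ _ => ?_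
  rw [Units.smul_def, Units.smul_def, map_zsmul]
  simp only [derivation_prod, hT]

end PairProduct

/-- A commutative real algebra containing elements `η i k` which behave like the inverse
differences `1 / (x_i - x_k)` with respect to commuting derivations `D a`, which behave like
the partial derivatives `∂ / ∂x_a`. -/
structure InvDiffAlgebra (d : ℕ) (A : Type*) [CommRing A] [Algebra ℝ A] where
  /-- the inverse differences -/
  η : Fin d → Fin d → A
  /-- the partial derivatives -/
  D : Fin d → Derivation ℝ A A
  comm : ∀ a b f, D a (D b f) = D b (D a f)
  η_self : ∀ i, η i i = 0
  η_skew : ∀ i k, η i k = -η k i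
  D_η : ∀ i k, D i (η i k) = -η i k ^ 2
  D_η_of_ne : ∀ a i k, a ≠ i → a ≠ k → D a (η i k) = 0
  η_mul_sub : ∀ i k j, i ≠ k → i ≠ j → k ≠ j → η i k * (η i j - η k j) = -(η i j * η k j)

namespace InvDiffAlgebra

variable {d : ℕ} {A : Type*} [CommRing A] [Algebra ℝ A] (S : InvDiffAlgebra d A)

/-- Iterated partial derivatives. -/
noncomputable def iter (a : Fin d) (n : ℕ) : A →ₗ[ℝ] A := (S.D a : A →ₗ[ℝ] A) ^ n

@[simp] lemma iter_zero (a : Fin d) (f : A) : S.iter a 0 f = f := rfl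

lemma iter_succ (a : Fin d) (n : ℕ) (f : A) : S.iter a (n + 1) f = S.iter a n (S.D a f) := by
  rw [iter, iter, pow_succ]
  rfl

lemma iter_succ' (a : Fin d) (n : ℕ) (f : A) : S.iter a (n + 1) f = S.D a (S.iter a n f) := by
  rw [iter, iter, pow_succ']
  rfl

lemma D_iter (a b : Fin d) (n : ℕ) (f : A) : S.D a (S.iter b n f) = S.iter b n (S.D a f) := by
  induction n generalizing f with
  | zero => rfl
  | succ n ih => rw [iter_succ, ih, iter_succ, S.comm]

lemma iter_comm (a b : Fin d) (m n : ℕ) (f : A) :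
    S.iter a m (S.iter b n f) = S.iter b n (S.iter a m f) := by
  induction m generalizing f with
  | zero => rfl
  | succ m ih => rw [iter_succ, D_iter, ih, iter_succ]

lemma iter_mul_of_D_eq_zero (a : Fin d) (n : ℕ) (g f : A) (hg : S.D a g = 0) :
    S.iter a n (g * f) = g * S.iter a n f := by
  induction n generalizing f with
  | zero => rfl
  | succ n ih => rw [iter_succ, Derivation.leibniz, hg, smul_zero, add_zero, smul_eq_mul, ih,
      iter_succ]

lemma iter_mul (a : Fin d) (n : ℕ) (f g : A) :
    S.iter a n (f * g) = ∑ ij ∈ Finset.HasAntidiagonal.antidiagonal n,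
      n.choose ij.1 • (S.iter a ij.1 f * S.iter a ij.2 g) := by
  induction n with
  | zero => simp
  | succ n ih =>
    rw [Finset.sum_antidiagonal_choose_succ_nsmul
      (fun i j => S.iter a i f * S.iter a j g), iter_succ', ih, map_sum,
      ← Finset.sum_add_distrib]
    refine Finset.sum_congr rfl fun ij hij => ?_
    rw [← Finset.HasAntidiagonal.mem_antidiagonal.1 hij, Nat.choose_symm_add, ← smul_add, map_nsmul,
      Derivation.leibniz, iter_succ', iter_succ', smul_eq_mul, smul_eq_mul]
    ring

lemma D_η_right (i k : Fin d) : S.D k (S.η i k) = S.η i k ^ 2 := by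
  rw [S.η_skew, map_neg, S.D_η]
  ring

lemma D_η_pow (i k : Fin d) (n : ℕ) : S.D i (S.η i k ^ n) = -((n : ℝ) • S.η i k ^ (n + 1)) := by
  cases n with
  | zero => simp
  | succ n =>
    rw [Derivation.leibniz_pow, S.D_η, smul_eq_mul, ← Nat.cast_smul_eq_nsmul ℝ,
      Nat.add_sub_cancel, ← smul_neg]
    congr 1
    ring

lemma D_η_pow_right (i k : Fin d) (n : ℕ) :
    S.D k (S.η i k ^ n) = (n : ℝ) • S.η i k ^ (n + 1) := by
  cases n with
  | zero => simp
  | succ n =>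
    rw [Derivation.leibniz_pow, S.D_η_right, smul_eq_mul, ← Nat.cast_smul_eq_nsmul ℝ,
      Nat.add_sub_cancel]
    congr 1
    ring

lemma D_η_pow_of_ne (a i k : Fin d) (h : a ≠ i) (h' : a ≠ k) (n : ℕ) :
    S.D a (S.η i k ^ n) = 0 := by
  rw [Derivation.leibniz_pow, S.D_η_of_ne a i k h h', smul_zero, smul_zero]

lemma iter_η_sq (i k : Fin d) (n : ℕ) :
    S.iter k n (S.η i k ^ 2) = ((n + 1).factorial : ℝ) • S.η i k ^ (n + 2) := by
  induction n with
  | zero => simp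
  | succ n ih =>
    rw [iter_succ', ih, Derivation.map_smul, D_η_pow_right, smul_smul, Nat.factorial_succ (n + 1)]
    push_cast
    congr 1
    ring

/-- The kernel: the mixed derivatives of `(x_i - x_k)^{-2}`. -/
noncomputable def kern (u v : Fin d × ℕ) : A :=
  S.iter u.1 u.2 (S.iter v.1 v.2 (S.η u.1 v.1 ^ 2))

lemma kern_comm (u v : Fin d × ℕ) : S.kern u v = S.kern v u := by
  rw [kern, kern, iter_comm, S.η_skew, neg_sq]

lemma kern_of_eq (u v : Fin d × ℕ) (h : u.1 = v.1) : S.kern u v = 0 := by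
  rw [kern, h, S.η_self]
  simp

/-- The pairing of the kernel with the normalized derivatives at `x_j`. -/
noncomputable def mode (j : Fin d) (p : ℕ) (u : Fin d × ℕ) : A :=
  S.iter u.1 u.2 (((p : ℝ) + 1) • S.η u.1 j ^ (p + 2))

lemma mode_eq (j : Fin d) (p : ℕ) (u : Fin d × ℕ) :
    S.mode j p u = -S.iter u.1 (u.2 + 1) (S.η u.1 j ^ (p + 1)) := by
  rw [mode, iter_succ, D_η_pow, map_neg, neg_neg]
  push_cast
  rfl

lemma kern_eq_mode (j : Fin d) (p : ℕ) (u : Fin d × ℕ) :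
    S.kern (j, p) u = (p.factorial : ℝ) • S.mode j p u := by
  rw [kern_comm, kern, iter_η_sq, mode, ← map_smul, smul_smul, Nat.factorial_succ]
  push_cast
  rw [mul_comm]

variable (z : Fin d → ℝ)

/-- The skew form with parameters `z`. -/
noncomputable def form :
    ((Fin d × ℕ) →₀ A) →ₗ[A] ((Fin d × ℕ) →₀ A) →ₗ[A] A :=
  Finsupp.linearCombination A fun u => Finsupp.linearCombination A fun v =>
    (z u.1 - z v.1) • S.kern u v

lemma form_single (u v : Fin d × ℕ) (a b : A) :
    S.form z (Finsupp.single u a) (Finsupp.single v b) =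
      (z u.1 - z v.1) • (a * b * S.kern u v) := by
  simp only [form, Finsupp.linearCombination_single, LinearMap.smul_apply, smul_eq_mul,
    mul_smul_comm, mul_assoc]

lemma form_skew (u v : (Fin d × ℕ) →₀ A) : S.form z u v = -S.form z v u := by
  induction u using Finsupp.induction_linear with
  | zero => simp
  | add u u' h h' => rw [map_add, LinearMap.add_apply, h, h', map_add, neg_add]
  | single u a =>
    induction v using Finsupp.induction_linear with
    | zero => simp
    | add v v' h h' => rw [map_add, h, h', map_add, LinearMap.add_apply, neg_add]
    | single v b =>
      rw [form_single, form_single, S.kern_comm v u, ← neg_smul, mul_comm b a]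
      congr 1
      ring

/-- The normalized basis vectors attached to `x_j`. -/
noncomputable def modeVec (j : Fin d) (p : ℕ) : (Fin d × ℕ) →₀ A :=
  Finsupp.single (j, p) (algebraMap ℝ A (p.factorial : ℝ)⁻¹)

lemma form_modeVec (j : Fin d) (p : ℕ) (v : Fin d × ℕ) :
    S.form z (modeVec j p) (Finsupp.single v 1) = (z j - z v.1) • S.mode j p v := by
  rw [modeVec, form_single, mul_one, kern_eq_mode, mul_smul_comm, ← Algebra.smul_def,
    smul_smul (p.factorial : ℝ), mul_inv_cancel₀ (by positivity), one_smul]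

/-- The image of a basis vector under the infinitesimal conformal transformation
generated by the vector field `(x - x_j)^{-n} ∂`. -/
noncomputable def conformalBasis (j : Fin d) (n : ℕ) (u : Fin d × ℕ) : (Fin d × ℕ) →₀ A :=
  if u.1 = j then ((u.2.factorial : ℝ) * (u.2 + 1)) • modeVec j (u.2 + n + 1)
  else ∑ ab ∈ Finset.HasAntidiagonal.antidiagonal (u.2 + 1),
      Finsupp.single (u.1, ab.2) ((u.2 + 1).choose ab.1 • S.iter u.1 ab.1 (S.η u.1 j ^ n)) +
    ∑ p ∈ Finset.range n, S.mode j (n - 1 - p) u • modeVec j p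

/-- The infinitesimal conformal transformation generated by the vector field
`(x - x_j)^{-n} ∂`. -/
noncomputable def conformal (j : Fin d) (n : ℕ) :
    ((Fin d × ℕ) →₀ A) →ₗ[A] ((Fin d × ℕ) →₀ A) :=
  Finsupp.linearCombination A (S.conformalBasis j n)

lemma conformal_single (j : Fin d) (n : ℕ) (u : Fin d × ℕ) :
    S.conformal j n (Finsupp.single u 1) = S.conformalBasis j n u := by
  rw [conformal, Finsupp.linearCombination_single, one_smul]

lemma conformal_modeVec (j : Fin d) (n p : ℕ) :
    S.conformal j n (modeVec j p) = ((p : ℝ) + 1) • modeVec j (p + n + 1) := by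
  rw [conformal, modeVec, Finsupp.linearCombination_single, conformalBasis, if_pos rfl,
    algebraMap_smul, smul_smul, ← mul_assoc, inv_mul_cancel₀ (by positivity), one_mul]

lemma form_conformal_of_eq (j : Fin d) (n o : ℕ) (v : Fin d × ℕ) :
    S.form z (S.conformal j n (Finsupp.single (j, o) 1)) (Finsupp.single v 1) =
      ((o.factorial : ℝ) * (o + 1)) • (z j - z v.1) • S.mode j (o + n + 1) v := by
  rw [conformal_single, conformalBasis, if_pos rfl, ← algebraMap_smul A, map_smul,
    LinearMap.smul_apply, algebraMap_smul, form_modeVec]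

lemma form_conformal_of_ne (j : Fin d) (n : ℕ) (u v : Fin d × ℕ) (hu : u.1 ≠ j) :
    S.form z (S.conformal j n (Finsupp.single u 1)) (Finsupp.single v 1) =
      (z u.1 - z v.1) • S.iter u.1 (u.2 + 1)
          (S.η u.1 j ^ n * S.iter v.1 v.2 (S.η u.1 v.1 ^ 2)) +
        (z j - z v.1) • ∑ p ∈ Finset.range n, S.mode j (n - 1 - p) u * S.mode j p v := by
  rw [conformal_single, conformalBasis, if_neg hu, map_add, LinearMap.add_apply, map_sum,
    map_sum, LinearMap.sum_apply, LinearMap.sum_apply]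
  congr 1
  · rw [iter_mul, Finset.smul_sum]
    refine Finset.sum_congr rfl fun ab _ => ?_
    rw [form_single, mul_one, kern, smul_mul_assoc]
  · rw [Finset.smul_sum]
    refine Finset.sum_congr rfl fun p _ => ?_
    rw [map_smul, LinearMap.smul_apply, form_modeVec, smul_eq_mul, mul_smul_comm]

lemma η_mul_pow_sub_pow (i k j : Fin d) (hik : i ≠ k) (hi : i ≠ j) (hk : k ≠ j) (n : ℕ) :
    S.η i k * (S.η i j ^ n - S.η k j ^ n) =
      -∑ p ∈ Finset.range n, S.η i j ^ (p + 1) * S.η k j ^ (n - 1 - p + 1) := by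
  rw [← geom_sum₂_mul, mul_left_comm, S.η_mul_sub i k j hik hi hk, mul_neg, Finset.sum_mul]
  congr 1
  refine Finset.sum_congr rfl fun p _ => ?_
  ring

lemma conformal_identity (i k j : Fin d) (hik : i ≠ k) (hi : i ≠ j) (hk : k ≠ j)
    (n o o' : ℕ) :
    S.iter i (o + 1) (S.η i j ^ n * S.iter k o' (S.η i k ^ 2)) +
      S.iter k (o' + 1) (S.η k j ^ n * S.iter i o (S.η k i ^ 2)) +
        ∑ p ∈ Finset.range n, S.mode j p (i, o) * S.mode j (n - 1 - p) (k, o') = 0 := by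
  have h := congrArg (fun f => S.iter i (o + 1) (S.iter k (o' + 1) f))
    (S.η_mul_pow_sub_pow i k j hik hi hk n)
  simp only [mul_sub, map_sub, map_neg, map_sum] at h
  have h1 : S.iter i (o + 1) (S.iter k (o' + 1) (S.η i k * S.η i j ^ n)) =
      S.iter i (o + 1) (S.η i j ^ n * S.iter k o' (S.η i k ^ 2)) := by
    rw [mul_comm, iter_mul_of_D_eq_zero _ _ _ _ _ (S.D_η_pow_of_ne k i j hik.symm hk n),
      iter_succ S k, D_η_right]
  have h2 : S.iter i (o + 1) (S.iter k (o' + 1) (S.η i k * S.η k j ^ n)) =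
      -S.iter k (o' + 1) (S.η k j ^ n * S.iter i o (S.η k i ^ 2)) := by
    rw [iter_comm, mul_comm, iter_mul_of_D_eq_zero _ i _ _ _ (S.D_η_pow_of_ne i k j hik hi n),
      iter_succ S i, S.D_η, S.η_skew i k, neg_sq, map_neg, mul_neg, map_neg]
  have h3 : ∀ p q, S.iter i (o + 1) (S.iter k (o' + 1) (S.η i j ^ (p + 1) * S.η k j ^ (q + 1))) =
      S.mode j p (i, o) * S.mode j q (k, o') := by
    intro p q
    rw [mode_eq, mode_eq,
      iter_mul_of_D_eq_zero _ _ _ _ _ (S.D_η_pow_of_ne k i j hik.symm hk _), mul_comm,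
      iter_mul_of_D_eq_zero _ i _ _ _ (by
        rw [D_iter, S.D_η_pow_of_ne i k j hik hi, map_zero])]
    ring
  rw [h1, h2] at h
  simp only [h3] at h
  linear_combination h

lemma sum_mode_symm (j : Fin d) (n : ℕ) (u v : Fin d × ℕ) :
    ∑ p ∈ Finset.range n, S.mode j (n - 1 - p) u * S.mode j p v =
      ∑ p ∈ Finset.range n, S.mode j p u * S.mode j (n - 1 - p) v := by
  rw [← Finset.sum_range_reflect]
  refine Finset.sum_congr rfl fun p hp => ?_
  have := Finset.mem_range.1 hp
  rw [show n - 1 - (n - 1 - p) = p by omega]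

lemma form_conformal_single (j : Fin d) (n : ℕ) (u v : Fin d × ℕ) :
    S.form z (S.conformal j n (Finsupp.single u 1)) (Finsupp.single v 1) +
      S.form z (Finsupp.single u 1) (S.conformal j n (Finsupp.single v 1)) = 0 := by
  have key : ∀ (o : ℕ) (v : Fin d × ℕ), v.1 ≠ j →
      S.form z (S.conformal j n (Finsupp.single (j, o) 1)) (Finsupp.single v 1) =
        S.form z (S.conformal j n (Finsupp.single v 1)) (Finsupp.single (j, o) 1) := by
    intro o v hv
    rw [form_conformal_of_eq, form_conformal_of_ne _ _ _ _ _ _ hv, sub_self (z j), zero_smul, add_zero,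
      iter_η_sq, mul_smul_comm, ← pow_add, map_smul, iter_succ, D_η_pow, mode, map_neg, map_smul,
      map_smul, Nat.factorial_succ]
    rw [show o + n + 1 + 2 = n + (o + 2) + 1 by ring]
    push_cast
    module
  rw [S.form_skew z (Finsupp.single u 1)]
  obtain ⟨i, o⟩ := u
  obtain ⟨k, o'⟩ := v
  by_cases hi : i = j
  · subst hi
    by_cases hk : k = i
    · subst hk
      simp only [form_conformal_of_eq]
      simp
    · rw [key o (k, o') hk, add_neg_cancel]
  · by_cases hk : k = j
    · subst hk
      rw [key o' (i, o) hi, add_neg_cancel]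
    · rw [form_conformal_of_ne _ _ _ _ (i, o) _ hi, form_conformal_of_ne _ _ _ _ (k, o') _ hk,
        sum_mode_symm]
      have hs : ∑ p ∈ Finset.range n, S.mode j (n - 1 - p) (k, o') * S.mode j p (i, o) =
          ∑ p ∈ Finset.range n, S.mode j p (i, o) * S.mode j (n - 1 - p) (k, o') :=
        Finset.sum_congr rfl fun p _ => mul_comm _ _
      rw [hs]
      by_cases hik : i = k
      · subst hik
        simp
      · have h := S.conformal_identity i k j hik hi hk n o o'
        have h2 : S.iter i (o + 1) (S.η i j ^ n * S.iter k o' (S.η i k ^ 2)) =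
            -(S.iter k (o' + 1) (S.η k j ^ n * S.iter i o (S.η k i ^ 2)) +
              ∑ p ∈ Finset.range n, S.mode j p (i, o) * S.mode j (n - 1 - p) (k, o')) := by
          linear_combination h
        simp only
        rw [h2]
        module

/-- The form is invariant under infinitesimal conformal transformations. -/
theorem form_conformal (j : Fin d) (n : ℕ) (u v : (Fin d × ℕ) →₀ A) :
    S.form z (S.conformal j n u) v + S.form z u (S.conformal j n v) = 0 := by
  have h : (S.form z).comp (S.conformal j n) + (S.form z).compl₂ (S.conformal j n) = 0 := by
    ext u v
    simpa using S.form_conformal_single z j n u v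
  simpa using LinearMap.congr_fun₂ h u v

end InvDiffAlgebra

lemma sum_range_le_sum_of_pos (B : Finset ℕ) (hB : ∀ x ∈ B, 1 ≤ x) :
    ∑ i ∈ Finset.range B.card, (i + 1) ≤ ∑ x ∈ B, x := by
  have h := Finset.sum_range_le_sum (s := B.map Nat.castEmbedding) (c := 1) (by
    intro x hx
    obtain ⟨y, hy, rfl⟩ := Finset.mem_map.1 hx
    simpa using hB y hy)
  rw [Finset.card_map, Finset.sum_map] at h
  have h2 : ((∑ i ∈ Finset.range B.card, (i + 1) : ℕ) : ℤ) ≤ ((∑ x ∈ B, x : ℕ) : ℤ) := by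
    push_cast
    simpa [add_comm] using h
  exact_mod_cast h2

lemma minLevel_eq (s : ℕ) : minLevel s = ∑ i ∈ Finset.range s, (i + 1) := by
  rw [minLevel, Finset.sum_range]

/-- Distinct positive modes of low total degree contain all small modes. -/
lemma exists_eq_of_sum_le {s : ℕ} (b : Fin s → ℕ) (hb : Function.Injective b)
    (hpos : ∀ i, 1 ≤ b i) (n m : ℕ) (hsum : ∑ i, b i = minLevel s + n) (hm : n + m ≤ s + 1)
    (p : ℕ) (hp : 1 ≤ p) (hpm : p < m) : ∃ i, b i = p := by
  by_contra hne
  push Not at hne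
  have hnot : p ∉ Finset.univ.image b := by
    intro h
    obtain ⟨i, -, hi⟩ := Finset.mem_image.1 h
    exact hne i hi
  have h := sum_range_le_sum_of_pos (insert p (Finset.univ.image b)) (by
    intro x hx
    rcases Finset.mem_insert.1 hx with rfl | hx
    · exact hp
    · obtain ⟨i, -, rfl⟩ := Finset.mem_image.1 hx
      exact hpos i)
  rw [Finset.card_insert_of_notMem hnot, Finset.sum_insert hnot,
    Finset.card_image_of_injective _ hb, Finset.card_univ, Fintype.card_fin,
    Finset.sum_image (fun i _ k _ h => hb h), hsum, Finset.sum_range_succ, ← minLevel_eq] at h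
  omega

namespace InvDiffAlgebra

variable {d : ℕ} {A : Type*} [CommRing A] [Algebra ℝ A] (S : InvDiffAlgebra d A)

/-- The first-order operators `ℒ_{-m}`. -/
noncomputable def lop (s : Fin d → ℕ) (j : Fin d) (m : ℕ) : A →ₗ[ℝ] A :=
  -∑ i ∈ Finset.univ.erase j,
    (LinearMap.mulLeft ℝ (S.η i j ^ (m - 1)) ∘ₗ (S.D i : A →ₗ[ℝ] A) +
      ((1 - (m : ℝ)) * (((s i + 1) * s i : ℕ) : ℝ) / 2) • LinearMap.mulLeft ℝ (S.η i j ^ m))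

lemma lop_apply (s : Fin d → ℕ) (j : Fin d) (m : ℕ) (f : A) :
    S.lop s j m f = -∑ i ∈ Finset.univ.erase j, (S.η i j ^ (m - 1) * S.D i f +
      ((1 - (m : ℝ)) * (((s i + 1) * s i : ℕ) : ℝ) / 2) • (S.η i j ^ m * f)) := by
  simp [lop]

/-- The shift of the basis vectors attached to `x_i`. -/
noncomputable def raise (i : Fin d) : ((Fin d × ℕ) →₀ A) →ₗ[A] ((Fin d × ℕ) →₀ A) :=
  Finsupp.linearCombination A fun u => if u.1 = i then Finsupp.single (u.1, u.2 + 1) 1 else 0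

omit [Algebra ℝ A] in
lemma raise_single_self (u : Fin d × ℕ) (a : A) :
    raise u.1 (Finsupp.single u a) = Finsupp.single (u.1, u.2 + 1) a := by
  simp [raise]

omit [Algebra ℝ A] in
lemma raise_single_of_ne (i : Fin d) (u : Fin d × ℕ) (a : A) (h : u.1 ≠ i) :
    raise i (Finsupp.single u a) = 0 := by
  simp [raise, h]

variable (z : Fin d → ℝ)

lemma D_kern (i : Fin d) (u v : Fin d × ℕ) (huv : u.1 ≠ v.1) :
    S.D i (S.kern u v) = (if u.1 = i then S.kern (u.1, u.2 + 1) v else 0) +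
      (if v.1 = i then S.kern u (v.1, v.2 + 1) else 0) := by
  split_ifs with h1 h2 h2
  · exact absurd (h1.trans h2.symm) huv
  · rw [add_zero, ← h1, kern, kern, ← iter_succ']
  · rw [zero_add, ← h2, kern, kern, D_iter, ← iter_succ']
  · rw [kern, D_iter, D_iter, S.D_η_pow_of_ne i _ _ (Ne.symm h1) (Ne.symm h2)]
    simp

lemma D_form_single (i : Fin d) (u v : Fin d × ℕ) (a b : ℝ) :
    S.D i (S.form z (Finsupp.single u (algebraMap ℝ A a))
        (Finsupp.single v (algebraMap ℝ A b))) =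
      S.form z (raise i (Finsupp.single u (algebraMap ℝ A a)))
          (Finsupp.single v (algebraMap ℝ A b)) +
        S.form z (Finsupp.single u (algebraMap ℝ A a))
          (raise i (Finsupp.single v (algebraMap ℝ A b))) := by
  have hr : ∀ (u : Fin d × ℕ) (c : A), raise i (Finsupp.single u c) =
      if u.1 = i then Finsupp.single (u.1, u.2 + 1) c else 0 := by
    intro u c
    split_ifs with h
    · rw [← h, raise_single_self]
    · exact raise_single_of_ne i u c h
  rw [hr, hr, form_single, ← map_mul, ← Algebra.smul_def, Derivation.map_smul,
    Derivation.map_smul]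
  by_cases huv : u.1 = v.1
  · rw [S.kern_of_eq u v huv]
    split_ifs <;> simp [form_single, huv]
  · rw [D_kern S i u v huv]
    split_ifs <;> simp [form_single, Algebra.smul_def, mul_assoc, mul_add]

section Slots

variable {K : Type*} [Fintype K] [DecidableEq K] (π : K ⊕ K → Fin d × ℕ) {s : Fin d → ℕ}
  (j : Fin d) (p : Fin (s j) → K ⊕ K)

/-- The vectors attached to the slots, with prescribed modes in the slots at `x_j`. -/
noncomputable def slotVec (b : Fin (s j) → ℕ) : K ⊕ K → ((Fin d × ℕ) →₀ A) :=
  Function.extend p (fun i => modeVec j (b i - 1)) (fun t => Finsupp.single (π t) 1)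

/-- The correlation function with prescribed modes at `x_j`. -/
noncomputable def corr (b : Fin (s j) → ℕ) : A :=
  pairAlt K (S.form z) (slotVec π j p b)

variable (hπ : Function.Injective π) (hπs : ∀ u, (∃ t, π t = u) ↔ u.2 < s u.1)
  (hp : ∀ i, π (p i) = (j, (i : ℕ)))
include hp

omit [Fintype K] [DecidableEq K] in
lemma slot_injective : Function.Injective p := by
  intro i k h
  have := congrArg (fun t => (π t).2) h
  simp only [hp] at this
  exact Fin.ext this

omit [Fintype K] [DecidableEq K] in
lemma slotVec_slot (b : Fin (s j) → ℕ) (i : Fin (s j)) :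
    slotVec (A := A) π j p b (p i) = modeVec j (b i - 1) :=
  (slot_injective π j p hp).extend_apply _ _ _

omit [Fintype K] [DecidableEq K] in
lemma slotVec_of_ne (b : Fin (s j) → ℕ) (t : K ⊕ K) (ht : (π t).1 ≠ j) :
    slotVec (A := A) π j p b t = Finsupp.single (π t) 1 := by
  refine Function.extend_apply' _ _ _ ?_
  rintro ⟨i, rfl⟩
  exact ht (by rw [hp])

lemma corr_swap (b : Fin (s j) → ℕ) (i k : Fin (s j)) (hik : i ≠ k) :
    S.corr z π j p (b ∘ Equiv.swap i k) = -S.corr z π j p b := by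
  have hinj := slot_injective π j p hp
  rw [corr, corr, ← AlternatingMap.map_swap _ _ (hinj.ne hik)]
  congr 1
  funext t
  rw [Function.comp_apply]
  by_cases ht : ∃ l, p l = t
  · obtain ⟨l, rfl⟩ := ht
    rw [slotVec_slot π j p hp, hinj.swap_apply, slotVec_slot π j p hp, Function.comp_apply]
  · have h1 : t ≠ p i := fun h => ht ⟨i, h.symm⟩
    have h2 : t ≠ p k := fun h => ht ⟨k, h.symm⟩
    rw [Equiv.swap_apply_of_ne_of_ne h1 h2, slotVec, slotVec, Function.extend_apply' _ _ _ ht,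
      Function.extend_apply' _ _ _ ht]

omit [Fintype K] in
lemma slotVec_update (b : Fin (s j) → ℕ) (i : Fin (s j)) (n : ℕ) :
    Function.update (slotVec (A := A) π j p b) (p i) (modeVec j (n - 1)) =
      slotVec π j p (Function.update b i n) := by
  have hinj := slot_injective π j p hp
  funext t
  by_cases ht : ∃ l, p l = t
  · obtain ⟨l, rfl⟩ := ht
    rw [slotVec_slot π j p hp]
    rcases eq_or_ne l i with rfl | hl
    · simp
    · rw [Function.update_of_ne (hinj.ne hl), Function.update_of_ne hl, slotVec_slot π j p hp]
  · have h1 : t ≠ p i := fun h => ht ⟨i, h.symm⟩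
    rw [Function.update_of_ne h1, slotVec, slotVec, Function.extend_apply' _ _ _ ht,
      Function.extend_apply' _ _ _ ht]

lemma pairAlt_slotVec_update_eq_zero (b : Fin (s j) → ℕ) (t : K ⊕ K) (ht : (π t).1 ≠ j)
    (n : ℕ) (h : ¬ Function.Injective b ∨ ∃ i, b i = n + 1) :
    pairAlt K (S.form z) (Function.update (slotVec π j p b) t (modeVec j n)) = 0 := by
  have hinj := slot_injective π j p hp
  have hne : ∀ i, p i ≠ t := fun i h => ht (by rw [← h, hp])
  rcases h with h | ⟨i, hi⟩
  · rw [Function.Injective] at h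
    push Not at h
    obtain ⟨i, k, hik, hne'⟩ := h
    refine AlternatingMap.map_eq_zero_of_eq _ _ (i := p i) (j := p k) ?_ (hinj.ne hne')
    rw [Function.update_of_ne (hne i), Function.update_of_ne (hne k), slotVec_slot π j p hp,
      slotVec_slot π j p hp, hik]
  · refine AlternatingMap.map_eq_zero_of_eq _ _ (i := p i) (j := t) ?_ (hne i)
    rw [Function.update_of_ne (hne i), slotVec_slot π j p hp, Function.update_self, hi,
      Nat.add_sub_cancel]

lemma D_corr (b : Fin (s j) → ℕ) (i : Fin d) (hi : i ≠ j) :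
    S.D i (S.corr z π j p b) = ∑ t ∈ Finset.univ.filter (fun t => (π t).1 = i),
      pairAlt K (S.form z) (Function.update (slotVec π j p b) t
        (Finsupp.single ((π t).1, (π t).2 + 1) 1)) := by
  have hreal : ∀ t, ∃ (u : Fin d × ℕ) (a : ℝ),
      slotVec (A := A) π j p b t = Finsupp.single u (algebraMap ℝ A a) := by
    intro t
    by_cases ht : ∃ l, p l = t
    · obtain ⟨l, rfl⟩ := ht
      exact ⟨_, _, slotVec_slot π j p hp b l⟩
    · exact ⟨π t, 1, by rw [slotVec, Function.extend_apply' _ _ _ ht, map_one]⟩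
  rw [corr, derivation_pairAlt (S.D i) (S.form z) (raise i), Finset.sum_filter]
  · refine Finset.sum_congr rfl fun t _ => ?_
    split_ifs with hti
    · rw [slotVec_of_ne π j p hp b t (by rw [hti]; exact hi), ← hti, raise_single_self]
    · by_cases ht : ∃ l, p l = t
      · obtain ⟨l, rfl⟩ := ht
        rw [slotVec_slot π j p hp, modeVec, raise_single_of_ne _ _ _ hi.symm,
          AlternatingMap.map_update_zero]
      · have : slotVec (A := A) π j p b t = Finsupp.single (π t) 1 := by
          rw [slotVec, Function.extend_apply' _ _ _ ht]
        rw [this, raise_single_of_ne _ _ _ hti, AlternatingMap.map_update_zero]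
  · intro t t'
    obtain ⟨u, a, hu⟩ := hreal t
    obtain ⟨v, c, hv⟩ := hreal t'
    rw [hu, hv, D_form_single]

include hπ hπs

omit [Fintype K] [DecidableEq K] in
lemma exists_slot (t : K ⊕ K) (ht : (π t).1 = j) : ∃ i, p i = t := by
  have h := (hπs (π t)).1 ⟨t, rfl⟩
  rw [ht] at h
  refine ⟨⟨(π t).2, h⟩, hπ ?_⟩
  rw [hp]
  exact Prod.ext ht.symm rfl

omit [DecidableEq K] hp in
lemma sum_offset (i : Fin d) :
    ∑ t ∈ Finset.univ.filter (fun t => (π t).1 = i), (((π t).2 : ℝ) + 1) =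
      (((s i + 1) * s i : ℕ) : ℝ) / 2 := by
  have h : ∑ t ∈ Finset.univ.filter (fun t => (π t).1 = i), (((π t).2 : ℝ) + 1) =
      ∑ o ∈ Finset.range (s i), ((o : ℝ) + 1) := by
    refine Finset.sum_bij (fun t _ => (π t).2) ?_ ?_ ?_ (fun _ _ => rfl)
    · intro t ht
      have h := (hπs (π t)).1 ⟨t, rfl⟩
      rw [(Finset.mem_filter.1 ht).2] at h
      exact Finset.mem_range.2 h
    · intro t ht t' ht' h
      refine hπ (Prod.ext ?_ h)
      rw [(Finset.mem_filter.1 ht).2, (Finset.mem_filter.1 ht').2]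
    · intro o ho
      obtain ⟨t, ht⟩ := (hπs (i, o)).2 (Finset.mem_range.1 ho)
      exact ⟨t, by simp [ht], by rw [ht]⟩
  rw [h]
  have : ∀ n : ℕ, ∑ o ∈ Finset.range n, ((o : ℝ) + 1) = (((n + 1) * n : ℕ) : ℝ) / 2 := by
    intro n
    induction n with
    | zero => simp
    | succ n ih => rw [Finset.sum_range_succ, ih]; push_cast; ring
  exact this _

omit hπ in
lemma pairAlt_conformal_outer (b : Fin (s j) → ℕ) (n : ℕ)
    (h : ¬ Function.Injective b ∨ ∀ k, k < n → ∃ i, b i = k + 1) (t : K ⊕ K)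
    (ht : (π t).1 ≠ j) :
    pairAlt K (S.form z) (Function.update (slotVec π j p b) t
        (S.conformal j n (slotVec π j p b t))) =
      S.η (π t).1 j ^ n * pairAlt K (S.form z) (Function.update (slotVec π j p b) t
          (Finsupp.single ((π t).1, (π t).2 + 1) 1)) +
        (-(n : ℝ) * (((π t).2 : ℝ) + 1)) •
          (S.η (π t).1 j ^ (n + 1) * S.corr z π j p b) := by
  have hft := slotVec_of_ne (A := A) π j p hp b t ht
  have hpair : ∑ k ∈ Finset.range n, pairAlt K (S.form z)
      (Function.update (slotVec π j p b) t (S.mode j (n - 1 - k) (π t) • modeVec j k)) = 0 := by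
    refine Finset.sum_eq_zero fun k hk => ?_
    rw [AlternatingMap.map_update_smul,
      S.pairAlt_slotVec_update_eq_zero z π j p hp b t ht k
        (h.imp_right fun h => h k (Finset.mem_range.1 hk)), smul_zero]
  have hsingle : ∀ (v : Fin d × ℕ) (a : A), pairAlt K (S.form z)
      (Function.update (slotVec π j p b) t (Finsupp.single v a)) =
        a * pairAlt K (S.form z) (Function.update (slotVec π j p b) t (Finsupp.single v 1)) := by
    intro v a
    rw [← smul_eq_mul a, ← AlternatingMap.map_update_smul, Finsupp.smul_single, smul_eq_mul,
      mul_one]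
  rw [hft, conformal_single, conformalBasis, if_neg ht, AlternatingMap.map_update_add,
    AlternatingMap.map_update_sum, AlternatingMap.map_update_sum, hpair, add_zero]
  rw [Finset.sum_congr rfl (fun ab _ => hsingle _ _), Finset.Nat.sum_antidiagonal_succ,
    Finset.sum_eq_single (0, (π t).2)]
  · congr 1
    · simp
    · have hself : Function.update (slotVec (A := A) π j p b) t
          (Finsupp.single ((π t).1, (π t).2) 1) = slotVec π j p b := by
        rw [Prod.mk.eta, ← hft, Function.update_eq_self]
      simp only [zero_add, Nat.choose_one_right, hself]
      rw [iter_succ, iter_zero, D_η_pow, ← Nat.cast_smul_eq_nsmul ℝ, ← neg_smul, smul_smul,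
        smul_mul_assoc, corr]
      congr 1
      push_cast
      ring
  · rintro ⟨a, o⟩ hao hne
    have hao' := Finset.HasAntidiagonal.mem_antidiagonal.1 hao
    simp only at hao'
    have ho : o < (π t).2 := by
      rcases Nat.eq_zero_or_pos a with rfl | ha
      · exact absurd (by rw [← hao', zero_add]) hne
      · omega
    have hlt := (hπs (π t)).1 ⟨t, rfl⟩
    obtain ⟨t', ht'⟩ := (hπs ((π t).1, o)).2 (ho.trans hlt)
    have htt : t' ≠ t := by
      rintro rfl
      rw [ht'] at ho
      exact lt_irrefl _ ho
    rw [AlternatingMap.map_eq_zero_of_eq _ _ (i := t') (j := t) _ htt, mul_zero]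
    rw [Function.update_of_ne htt, Function.update_self,
      slotVec_of_ne π j p hp b t' (by rw [ht']; exact ht), ht']
  · intro hne
    exact absurd (Finset.HasAntidiagonal.mem_antidiagonal.2 (by simp)) hne

/-- The Ward identity: the operator `ℒ_{-(n+1)}` acts by shifting the modes. -/
lemma lop_corr (b : Fin (s j) → ℕ) (hb : ∀ i, 1 ≤ b i) (n : ℕ)
    (h : ¬ Function.Injective b ∨ ∀ k, k < n → ∃ i, b i = k + 1) :
    S.lop s j (n + 1) (S.corr z π j p b) =
      ∑ i, (b i : ℝ) • S.corr z π j p (Function.update b i (b i + (n + 1))) := by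
  have h0 := sum_pairAlt_update_eq_zero (S.form z) (S.conformal j n) (slotVec π j p b)
    (S.form_conformal z j n)
  rw [← Finset.sum_filter_add_sum_filter_not _ (fun t => (π t).1 = j)] at h0
  have hin : ∑ t ∈ Finset.univ.filter (fun t => (π t).1 = j),
      pairAlt K (S.form z) (Function.update (slotVec π j p b) t
        (S.conformal j n (slotVec π j p b t))) =
      ∑ i, (b i : ℝ) • S.corr z π j p (Function.update b i (b i + (n + 1))) := by
    symm
    refine Finset.sum_bij (fun i _ => p i) ?_ ?_ ?_ ?_
    · intro i _
      simp [hp]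
    · intro i _ k _ h
      exact slot_injective π j p hp h
    · intro t ht
      obtain ⟨i, hi⟩ := exists_slot π j p hπ hπs hp t (Finset.mem_filter.1 ht).2
      exact ⟨i, Finset.mem_univ _, hi⟩
    · intro i _
      have hbi := hb i
      rw [slotVec_slot π j p hp, conformal_modeVec, ← algebraMap_smul A (((b i - 1 : ℕ) : ℝ) + 1),
        AlternatingMap.map_update_smul, algebraMap_smul,
        show b i - 1 + n + 1 = b i + (n + 1) - 1 by omega, slotVec_update π j p hp, corr]
      congr 1
      rw [Nat.cast_sub hbi]
      simp
  have hout : ∑ t ∈ Finset.univ.filter (fun t => ¬(π t).1 = j),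
      pairAlt K (S.form z) (Function.update (slotVec π j p b) t
        (S.conformal j n (slotVec π j p b t))) = -S.lop s j (n + 1) (S.corr z π j p b) := by
    rw [lop_apply, neg_neg, ← Finset.sum_fiberwise_of_maps_to
      (s := Finset.univ.filter (fun t => ¬(π t).1 = j)) (t := Finset.univ.erase j)
      (g := fun t => (π t).1) (fun t ht => by simpa using ht)]
    refine Finset.sum_congr rfl fun i hi => ?_
    have hij := Finset.ne_of_mem_erase hi
    have hfilter : (Finset.univ.filter (fun t => ¬(π t).1 = j)).filter (fun t => (π t).1 = i) =
        Finset.univ.filter (fun t => (π t).1 = i) := by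
      ext t
      simp only [Finset.mem_filter, Finset.mem_univ, true_and, and_iff_right_iff_imp]
      intro h
      rwa [h]
    rw [hfilter, S.D_corr z π j p hp b i hij, Finset.mul_sum, mul_div_assoc,
      ← sum_offset π hπ hπs i, Finset.mul_sum, Finset.sum_smul, ← Finset.sum_add_distrib]
    refine Finset.sum_congr rfl fun t ht => ?_
    have hti := (Finset.mem_filter.1 ht).2
    rw [S.pairAlt_conformal_outer z π j p hπs hp b n h t (by rw [hti]; exact hij), hti,
      Nat.add_sub_cancel]
    congr 2
    push_cast
    ring
  rw [hin, hout, add_neg_eq_zero] at h0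
  exact h0.symm

end Slots

end InvDiffAlgebra

section Operator

variable {M : Type*} [AddCommGroup M] [Module ℝ M]

/-- The Benoit–Saint-Aubin combination of the operators `L m`. -/
noncomputable def bsaOp (L : ℕ → M →ₗ[ℝ] M) (S : ℕ) (c : ℝ) : M →ₗ[ℝ] M :=
  ∑ k ∈ Finset.Icc 1 S,
    ∑ m ∈ (Finset.Nat.antidiagonalTuple k S).filter (fun m => ∀ i, 1 ≤ m i),
      ((-2 : ℝ) ^ (S - k) * c /
          ∏ l ∈ Finset.Ico 1 k,
            ((∑ i ∈ Finset.univ.filter (fun i : Fin k => (i : ℕ) < l), (m i : ℝ)) *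
              ∑ i ∈ Finset.univ.filter (fun i : Fin k => l ≤ (i : ℕ)), (m i : ℝ))) •
        (List.ofFn m).foldr (fun a T => L a ∘ₗ T) LinearMap.id

lemma foldr_comp_apply (L : ℕ → M →ₗ[ℝ] M) (l : List ℕ) (f : M) :
    l.foldr (fun a T => L a ∘ₗ T) LinearMap.id f = l.foldr (fun a w => L a w) f := by
  induction l with
  | nil => rfl
  | cons a l ih => simp [ih]

lemma bsaOp_apply (L : ℕ → M →ₗ[ℝ] M) (S : ℕ) (c : ℝ) (f : M) :
    bsaOp L S c f = ∑ k ∈ Finset.Icc 1 S,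
      ∑ m ∈ (Finset.Nat.antidiagonalTuple k S).filter (fun m => ∀ i, 1 ≤ m i),
        ((-2 : ℝ) ^ (S - k) * c /
            ∏ l ∈ Finset.Ico 1 k,
              ((∑ i ∈ Finset.univ.filter (fun i : Fin k => (i : ℕ) < l), (m i : ℝ)) *
                ∑ i ∈ Finset.univ.filter (fun i : Fin k => l ≤ (i : ℕ)), (m i : ℝ))) •
          (List.ofFn m).foldr (fun a w => L a w) f := by
  simp only [bsaOp, LinearMap.sum_apply, LinearMap.smul_apply, foldr_comp_apply]

end Operator

lemma levelSum_zero_eq {M : Type*} [AddCommGroup M] [Module ℝ M] {s : ℕ}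
    (w : (Fin s → ℕ) → M) (h : ℝ⟦X⟧) (hh : constantCoeff h = 1) :
    levelSum w 0 (fun _ => h) = w fun i => i + 1 := by
  rw [levelSum_apply, modeSum_apply, Finset.sum_eq_single fun i : Fin s => (i : ℕ) + 1]
  · rw [Finset.prod_eq_one, one_smul]
    intro i _
    rw [coeff_X_pow_mul', if_pos le_rfl, Nat.sub_self, coeff_zero_eq_constantCoeff_apply, hh]
  · intro b hb hne
    simp only [Finset.mem_piAntidiag, Finset.mem_univ, implies_true, and_true, add_zero] at hb
    by_cases hall : ∀ i : Fin s, (i : ℕ) + 1 ≤ b i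
    · refine absurd ?_ hne
      have := (Finset.sum_eq_sum_iff_of_le fun i _ => hall i).1 (by rw [hb, minLevel])
      funext i
      exact (this i (Finset.mem_univ i)).symm
    · push Not at hall
      obtain ⟨i, hi⟩ := hall
      rw [Finset.prod_eq_zero (Finset.mem_univ i), zero_smul]
      rw [coeff_X_pow_mul', if_neg (by omega)]
  · intro h
    refine absurd ?_ h
    simp [minLevel]

namespace InvDiffAlgebra

variable {d : ℕ} {A : Type*} [CommRing A] [Algebra ℝ A] (S : InvDiffAlgebra d A)
  (z : Fin d → ℝ) {K : Type*} [Fintype K] [DecidableEq K] (π : K ⊕ K → Fin d × ℕ)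
  {s : Fin d → ℕ} (j : Fin d) (p : Fin (s j) → K ⊕ K)
  (hπ : Function.Injective π) (hπs : ∀ u, (∃ t, π t = u) ↔ u.2 < s u.1)
  (hp : ∀ i, π (p i) = (j, (i : ℕ)))
include hπ hπs hp

lemma lop_levelSum (n m : ℕ) (hnm : n + (m + 1) ≤ s j + 1) (h : Fin (s j) → ℝ⟦X⟧) :
    S.lop s j (m + 1) (levelSum (S.corr z π j p) n h) =
      ∑ i, levelSum (S.corr z π j p) (n + (m + 1)) (Function.update h i
        (X ^ (m + 1) * ((((i : ℕ) : ℝ) + 1) • h i + X * derivative ℝ (h i)))) := by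
  have key := sum_shift_eq (S.corr z π j p) (minLevel (s j) + n) (m + 1)
    (fun i => X ^ ((i : ℕ) + 1) * h i)
  rw [levelSum_apply, modeSum_apply, map_sum]
  rw [Finset.sum_congr rfl (fun i _ => levelSum_apply _ _ _)]
  simp_rw [shifted_update]
  simp_rw [X_mul_derivative_shifted] at key
  rw [add_assoc] at key
  simp_rw [mul_left_comm (X ^ (m + 1) : ℝ⟦X⟧)] at key
  rw [← key]
  refine Finset.sum_congr rfl fun b hb => ?_
  simp only [Finset.mem_piAntidiag, Finset.mem_univ, implies_true, and_true] at hb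
  rw [LinearMap.map_smul]
  by_cases h0 : ∏ i, coeff (b i) (X ^ ((i : ℕ) + 1) * h i) = 0
  · rw [h0, zero_smul, zero_smul]
  · have hbi : ∀ i : Fin (s j), (i : ℕ) + 1 ≤ b i := by
      intro i
      by_contra hlt
      refine h0 (Finset.prod_eq_zero (Finset.mem_univ i) ?_)
      rw [coeff_X_pow_mul', if_neg hlt]
    have hpos : ∀ i, 1 ≤ b i := fun i => le_trans (by omega) (hbi i)
    congr 1
    refine S.lop_corr z π j p hπ hπs hp b hpos m ?_
    by_cases hinj : Function.Injective b
    · right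
      intro k hk
      exact exists_eq_of_sum_le b hinj hpos n (m + 1) hb hnm (k + 1) (by omega) (by omega)
    · exact Or.inl hinj

/-- The correlation function with the lowest modes satisfies the Benoit–Saint-Aubin
equation. -/
theorem bsaOp_corr (c : ℝ) :
    bsaOp (S.lop s j) (s j + 1) c (S.corr z π j p fun i => i + 1) = 0 := by
  set R : ℝ⟦X⟧ := invSqrtSeries + (2 : ℝ) • (X * invSqrtSeries) with hR
  have hR0 : constantCoeff R = 1 := by
    rw [hR, map_add, PowerSeries.smul_eq_C_mul, invSqrtSeries, map_mul, map_mul,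
      constantCoeff_mk, constantCoeff_X, zero_mul, mul_zero, add_zero, invSqrtCoeff]
  rw [← levelSum_zero_eq (S.corr z π j p) R hR0, bsaOp_apply]
  refine bsa_sum_eq_zero (S.lop s j) (fun r => levelSum (S.corr z π j p) r fun _ => R)
    (s j + 1) (by omega) c ?_
  intro r _ hrS
  rw [← levelSum_recursion (S.corr z π j p) (S.corr_swap z π j p hp) r invSqrtSeries R hR
    derivative_invSqrtSeries]
  refine Finset.sum_congr rfl fun m hm => ?_
  obtain ⟨hm1, hmr⟩ := Finset.mem_Icc.1 hm
  obtain ⟨m, rfl⟩ := Nat.exists_eq_add_of_le' hm1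
  rw [S.lop_levelSum z π j p hπ hπs hp (r - (m + 1)) m (by omega), Nat.sub_add_cancel hmr]

/-- The pairing of the basis vectors satisfies the Benoit–Saint-Aubin equation. -/
theorem bsaOp_pairAlt (c : ℝ) :
    bsaOp (S.lop s j) (s j + 1) c
      (pairAlt K (S.form z) fun t => Finsupp.single (π t) 1) = 0 := by
  let a : K ⊕ K → ℝ := fun t => if (π t).1 = j then (((π t).2.factorial : ℝ))⁻¹ else 1
  have ha : ∏ t, a t ≠ 0 := by
    refine Finset.prod_ne_zero_iff.2 fun t _ => ?_
    simp only [a]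
    split_ifs
    · positivity
    · exact one_ne_zero
  have hcorr : S.corr z π j p (fun i => i + 1) =
      (∏ t, a t) • pairAlt K (S.form z) fun t => Finsupp.single (π t) 1 := by
    rw [← algebraMap_smul A, map_prod, ← AlternatingMap.coe_multilinearMap,
      ← MultilinearMap.map_smul_univ, AlternatingMap.coe_multilinearMap, corr]
    congr 1
    funext t
    by_cases ht : (π t).1 = j
    · obtain ⟨i, rfl⟩ := exists_slot π j p hπ hπs hp t ht
      rw [slotVec_slot π j p hp, modeVec]
      simp [a, hp, Algebra.algebraMap_eq_smul_one]
    · rw [slotVec_of_ne π j p hp _ t ht]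
      simp [a, ht]
  have h := S.bsaOp_corr z π j p hπ hπs hp c
  rw [hcorr, LinearMap.map_smul] at h
  exact (smul_eq_zero.1 h).resolve_left ha

end InvDiffAlgebra

section ChamberAlgebra

variable (d : ℕ)

/-- The chamber as a type. -/
abbrev Chamber : Type := {x : ℕ → ℝ // chamber d x}

/-- The inverse differences as functions on the chamber. -/
noncomputable def invDiff (i k : Fin d) : Chamber d → ℝ := fun x => (x.1 i - x.1 k)⁻¹

/-- The algebra of functions on the chamber generated by the inverse differences. -/
noncomputable abbrev chamberAlg : Subalgebra ℝ (Chamber d → ℝ) :=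
  Algebra.adjoin ℝ (Set.range fun ik : Fin d × Fin d => invDiff d ik.1 ik.2)

variable {d}

lemma eventually_chamber_update (x : Chamber d) (a : ℕ) :
    ∀ᶠ t in nhds (x.1 a), chamber d (Function.update x.1 a t) := by
  have hcont : ∀ i : ℕ, Continuous fun t : ℝ => Function.update x.1 a t i := by
    intro i
    exact (continuous_apply (A := fun _ => ℝ) i).comp (continuous_const.update a continuous_id)
  have h : ∀ᶠ t in nhds (x.1 a), ∀ j ∈ Finset.range d, ∀ i ∈ Finset.range j,
      Function.update x.1 a t i < Function.update x.1 a t j := by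
    rw [Filter.eventually_all_finset]
    intro j hj
    rw [Filter.eventually_all_finset]
    intro i hi
    refine (hcont i).continuousAt.eventually_lt (hcont j).continuousAt ?_
    rw [Function.update_eq_self]
    exact x.2 i j (Finset.mem_range.1 hi) (Finset.mem_range.1 hj)
  filter_upwards [h] with t ht i j hij hjd
  exact ht j (Finset.mem_range.2 hjd) i (Finset.mem_range.2 hij)

/-- The extension of a function on the chamber by zero. -/
noncomputable def extendZero (f : Chamber d → ℝ) (y : ℕ → ℝ) : ℝ :=
  if h : chamber d y then f ⟨y, h⟩ else 0

/-- `g` is the partial derivative of `f` with respect to `x_a` on the chamber. -/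
def HasPartial (a : Fin d) (f g : Chamber d → ℝ) : Prop :=
  ∀ x : Chamber d, HasDerivAt (fun t => extendZero f (Function.update x.1 a t)) (g x) (x.1 a)

lemma HasPartial.hasDerivAt {a : Fin d} {f g : Chamber d → ℝ} (h : HasPartial a f g)
    (F : (ℕ → ℝ) → ℝ) (hF : ∀ y : Chamber d, F y.1 = f y) (x : Chamber d) :
    HasDerivAt (fun t => F (Function.update x.1 a t)) (g x) (x.1 a) := by
  refine (h x).congr_of_eventuallyEq ?_
  filter_upwards [eventually_chamber_update x a] with t ht
  rw [extendZero, dif_pos ht, ← hF]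

lemma extendZero_apply (f : Chamber d → ℝ) (x : Chamber d) : extendZero f x.1 = f x := by
  rw [extendZero, dif_pos x.2]

lemma hasPartial_of_hasDerivAt {a : Fin d} {f g : Chamber d → ℝ} (F : (ℕ → ℝ) → ℝ)
    (hF : ∀ y : Chamber d, F y.1 = f y)
    (h : ∀ x : Chamber d, HasDerivAt (fun t => F (Function.update x.1 a t)) (g x) (x.1 a)) :
    HasPartial a f g := by
  intro x
  refine (h x).congr_of_eventuallyEq ?_
  filter_upwards [eventually_chamber_update x a] with t ht
  rw [extendZero, dif_pos ht, ← hF]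

lemma HasPartial.unique {a : Fin d} {f g g' : Chamber d → ℝ} (h : HasPartial a f g)
    (h' : HasPartial a f g') : g = g' :=
  funext fun x => (h x).unique (h' x)

lemma hasPartial_const (a : Fin d) (c : ℝ) : HasPartial a (fun _ => c) 0 :=
  hasPartial_of_hasDerivAt (fun _ => c) (fun _ => rfl) fun _ => hasDerivAt_const _ _

lemma HasPartial.add {a : Fin d} {f g f' g' : Chamber d → ℝ} (h : HasPartial a f g)
    (h' : HasPartial a f' g') : HasPartial a (f + f') (g + g') :=
  hasPartial_of_hasDerivAt (fun y => extendZero f y + extendZero f' y)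
    (fun y => by simp [extendZero_apply]) fun x => (h x).add (h' x)

lemma HasPartial.mul {a : Fin d} {f g f' g' : Chamber d → ℝ} (h : HasPartial a f g)
    (h' : HasPartial a f' g') : HasPartial a (f * f') (g * f' + f * g') :=
  hasPartial_of_hasDerivAt (fun y => extendZero f y * extendZero f' y)
    (fun y => by simp [extendZero_apply]) fun x => by
      have := (h x).mul (h' x)
      simp only [Function.update_eq_self, extendZero_apply] at this
      exact this

lemma chamber_injOn (x : Chamber d) {i k : Fin d} (h : i ≠ k) : x.1 i ≠ x.1 k := by
  rcases lt_or_gt_of_ne h with h | h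
  · exact (x.2 i k h k.2).ne
  · exact ne_comm.1 (x.2 k i h i.2).ne

/-- The derivative of `x_i - x_k` with respect to `x_a`. -/
noncomputable def diffDelta (a i k : Fin d) : ℝ :=
  (if a = i then 1 else 0) - (if a = k then 1 else 0)

lemma hasPartial_invDiff (a i k : Fin d) :
    HasPartial a (invDiff d i k) (-diffDelta a i k • invDiff d i k ^ 2) := by
  refine hasPartial_of_hasDerivAt (fun y => (y i - y k)⁻¹) (fun _ => rfl) fun x => ?_
  rcases eq_or_ne i k with rfl | hik
  · simp only [sub_self, inv_zero, diffDelta, neg_zero, zero_smul]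
    exact hasDerivAt_const _ _
  · have hc : ∀ i : Fin d, HasDerivAt (fun t : ℝ => Function.update x.1 (a : ℕ) t i)
        (if a = i then 1 else 0) (x.1 a) := by
      intro i
      split_ifs with h
      · subst h
        simpa using hasDerivAt_id' (x.1 a)
      · have : (i : ℕ) ≠ a := fun e => h (Fin.ext e.symm)
        simpa [Function.update_of_ne this] using hasDerivAt_const (x.1 a) (x.1 i)
    have h0 : x.1 i - x.1 k ≠ 0 := sub_ne_zero.2 (chamber_injOn x hik)
    have h := ((hc i).sub (hc k)).inv (by simpa using h0)
    refine h.congr_deriv ?_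
    simp only [Pi.smul_apply, Pi.pow_apply, Pi.sub_apply, invDiff, diffDelta, smul_eq_mul,
      Function.update_eq_self]
    field_simp

lemma exists_hasPartial (a : Fin d) (f : Chamber d → ℝ) (hf : f ∈ chamberAlg d) :
    ∃ g ∈ chamberAlg d, HasPartial a f g := by
  induction hf using Algebra.adjoin_induction with
  | mem f hf =>
    obtain ⟨⟨i, k⟩, rfl⟩ := hf
    exact ⟨_, Subalgebra.smul_mem _ (Subalgebra.pow_mem _
      (Algebra.subset_adjoin (Set.mem_range_self (i, k))) 2) _, hasPartial_invDiff a i k⟩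
  | algebraMap c => exact ⟨0, Subalgebra.zero_mem _, hasPartial_const a c⟩
  | add f f' _ _ h h' =>
    obtain ⟨g, hg, h⟩ := h
    obtain ⟨g', hg', h'⟩ := h'
    exact ⟨_, Subalgebra.add_mem _ hg hg', h.add h'⟩
  | mul f f' hf hf' h h2 =>
    obtain ⟨g, hg, h⟩ := h
    obtain ⟨g', hg', h2⟩ := h2
    exact ⟨_, Subalgebra.add_mem _ (Subalgebra.mul_mem _ hg hf') (Subalgebra.mul_mem _ hf hg'),
      h.mul h2⟩

/-- The partial derivative of an element of the chamber algebra. -/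
noncomputable def chamberPartial (a : Fin d) (f : chamberAlg d) : chamberAlg d :=
  ⟨(exists_hasPartial a f.1 f.2).choose, (exists_hasPartial a f.1 f.2).choose_spec.1⟩

lemma hasPartial_chamberPartial (a : Fin d) (f : chamberAlg d) :
    HasPartial a f.1 (chamberPartial a f).1 :=
  (exists_hasPartial a f.1 f.2).choose_spec.2

lemma chamberPartial_eq {a : Fin d} {f g : chamberAlg d} (h : HasPartial a f.1 g.1) :
    chamberPartial a f = g :=
  Subtype.ext ((hasPartial_chamberPartial a f).unique h)

/-- The partial derivatives as derivations of the chamber algebra. -/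
noncomputable def chamberDeriv (a : Fin d) : Derivation ℝ (chamberAlg d) (chamberAlg d) :=
  Derivation.mk'
    { toFun := chamberPartial a
      map_add' := fun f g => chamberPartial_eq
        ((hasPartial_chamberPartial a f).add (hasPartial_chamberPartial a g))
      map_smul' := fun c f => chamberPartial_eq (by
        have h := (hasPartial_const a c).mul (hasPartial_chamberPartial a f)
        rw [zero_mul, zero_add] at h
        exact h) }
    fun f g => chamberPartial_eq (by
      have h := (hasPartial_chamberPartial a f).mul (hasPartial_chamberPartial a g)
      rw [add_comm, mul_comm (chamberPartial a f).1] at h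
      exact h)

/-- The inverse differences as elements of the chamber algebra. -/
noncomputable def chamberInv (i k : Fin d) : chamberAlg d :=
  ⟨invDiff d i k, Algebra.subset_adjoin ⟨(i, k), rfl⟩⟩

lemma chamberDeriv_chamberInv (a i k : Fin d) :
    chamberDeriv a (chamberInv i k) = -diffDelta a i k • chamberInv i k ^ 2 :=
  chamberPartial_eq (hasPartial_invDiff a i k)

lemma chamberDeriv_comm (a b : Fin d) (f : chamberAlg d) :
    chamberDeriv a (chamberDeriv b f) = chamberDeriv b (chamberDeriv a f) := by
  have h : ⁅chamberDeriv a, chamberDeriv b⁆ = (0 : Derivation ℝ (chamberAlg d) _) := by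
    refine Derivation.ext_of_adjoin_eq_top _ Algebra.adjoin_adjoin_coe_preimage ?_
    rintro ⟨f, hf⟩ ⟨⟨i, k⟩, rfl⟩
    change ⁅chamberDeriv a, chamberDeriv b⁆ (chamberInv i k) = 0
    rw [Derivation.commutator_apply, chamberDeriv_chamberInv, chamberDeriv_chamberInv,
      Derivation.map_smul, Derivation.map_smul, Derivation.leibniz_pow, Derivation.leibniz_pow,
      chamberDeriv_chamberInv, chamberDeriv_chamberInv]
    simp only [smul_eq_mul, Algebra.smul_def]
    ring
  have h2 := congrArg (fun D => D f) h
  simp only [Derivation.commutator_apply, Derivation.zero_apply] at h2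
  exact sub_eq_zero.1 h2

/-- The chamber algebra with its inverse differences and partial derivatives. -/
noncomputable def chamberStructure (d : ℕ) : InvDiffAlgebra d (chamberAlg d) where
  η := chamberInv
  D := chamberDeriv
  comm := chamberDeriv_comm
  η_self i := Subtype.ext (funext fun x => by simp [chamberInv, invDiff])
  η_skew i k := Subtype.ext (funext fun x => by
    simp only [chamberInv, invDiff, NegMemClass.coe_neg, Pi.neg_apply]
    rw [← inv_neg, neg_sub])
  D_η i k := by
    rcases eq_or_ne i k with rfl | h
    · have : chamberInv i i = 0 := Subtype.ext (funext fun x => by simp [chamberInv, invDiff])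
      rw [this, map_zero]
      simp
    · rw [chamberDeriv_chamberInv, diffDelta, if_pos rfl, if_neg h, sub_zero, neg_smul, one_smul]
  D_η_of_ne a i k hi hk := by
    rw [chamberDeriv_chamberInv, diffDelta, if_neg hi, if_neg hk, sub_zero, neg_zero, zero_smul]
  η_mul_sub i k j hik hij hkj := Subtype.ext (funext fun x => by
    have h1 := sub_ne_zero.2 (chamber_injOn x hik)
    have h2 := sub_ne_zero.2 (chamber_injOn x hij)
    have h3 := sub_ne_zero.2 (chamber_injOn x hkj)
    simp only [chamberInv, invDiff, NegMemClass.coe_neg, Pi.neg_apply, MulMemClass.coe_mul,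
      Pi.mul_apply, AddSubgroupClass.coe_sub, Pi.sub_apply]
    field_simp
    ring)

/-- Evaluation of the elements of the chamber algebra at a point. -/
noncomputable def chamberEval (x : Chamber d) : chamberAlg d →ₐ[ℝ] ℝ :=
  (Pi.evalAlgHom ℝ (fun _ : Chamber d => ℝ) x).comp (chamberAlg d).val

lemma Lop_eq_lop (s : ℕ → ℕ) (j : Fin d) (m : ℕ) (hm : 1 ≤ m) (F : (ℕ → ℝ) → ℝ)
    (f : chamberAlg d) (hF : ∀ x : Chamber d, F x.1 = chamberEval x f) (x : Chamber d) :
    Lop d s j m F x.1 = chamberEval x ((chamberStructure d).lop (fun i => s i) j m f) := by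
  rw [Lop, InvDiffAlgebra.lop_apply, map_neg, map_sum, neg_inj]
  symm
  refine Finset.sum_bij (fun i _ => (i : ℕ)) ?_ ?_ ?_ ?_
  · intro i hi
    refine Finset.mem_erase.2 ⟨fun h => Finset.ne_of_mem_erase hi (Fin.ext h),
      Finset.mem_range.2 i.2⟩
  · intro i _ k _ h
    exact Fin.ext h
  · intro i hi
    obtain ⟨hne, hlt⟩ := Finset.mem_erase.1 hi
    exact ⟨⟨i, Finset.mem_range.1 hlt⟩, Finset.mem_erase.2
      ⟨fun h => hne (congrArg Fin.val h), Finset.mem_univ _⟩, rfl⟩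
  · intro i _
    have hη : chamberEval x ((chamberStructure d).η i j) = (x.1 i - x.1 j)⁻¹ := rfl
    have hD : chamberEval x ((chamberStructure d).D i f) =
        deriv (fun t => F (Function.update x.1 i t)) (x.1 i) :=
      ((hasPartial_chamberPartial i f).hasDerivAt F hF x).deriv.symm
    rw [map_add, map_mul, map_pow, map_smul, map_mul, map_pow, hη, hD, hF, smul_eq_mul, mul_assoc,
      show (1 : ℤ) - (m : ℤ) = -((m - 1 : ℕ) : ℤ) by omega, zpow_neg, zpow_natCast, inv_pow,
      zpow_neg, zpow_natCast, inv_pow]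

lemma foldr_Lop_eq (s : ℕ → ℕ) (j : Fin d) (l : List ℕ) (hl : ∀ m ∈ l, 1 ≤ m)
    (F : (ℕ → ℝ) → ℝ) (f : chamberAlg d) (hF : ∀ x : Chamber d, F x.1 = chamberEval x f)
    (x : Chamber d) :
    l.foldr (Lop d s j) F x.1 = chamberEval x
      (l.foldr (fun m w => (chamberStructure d).lop (fun i => s i) j m w) f) := by
  induction l generalizing x with
  | nil => exact hF x
  | cons m l ih =>
    rw [List.foldr_cons, List.foldr_cons]
    exact Lop_eq_lop s j m (hl m List.mem_cons_self) _ _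
      (fun y => ih (fun n hn => hl n (List.mem_cons_of_mem m hn)) y) x

end ChamberAlgebra

section Ballot

variable {N : ℕ}

/-- The number of elements of `A` to the left of `t`. -/
noncomputable def countLt (A : Finset (Fin (2 * N))) (t : ℕ) : ℕ :=
  (A.filter fun a : Fin (2 * N) => (a : ℕ) < t).card

lemma countLt_succ_of_mem {A : Finset (Fin (2 * N))} {a : Fin (2 * N)} (ha : a ∈ A) :
    countLt A (a + 1) = countLt A a + 1 := by
  have : A.filter (fun b : Fin (2 * N) => (b : ℕ) < a + 1) =
      insert a (A.filter fun b : Fin (2 * N) => (b : ℕ) < a) := by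
    ext b
    simp only [Finset.mem_filter, Finset.mem_insert, Fin.ext_iff]
    constructor
    · rintro ⟨h1, h2⟩
      rcases Nat.lt_succ_iff_lt_or_eq.1 h2 with h | h
      · exact Or.inr ⟨h1, h⟩
      · exact Or.inl h
    · rintro (h | ⟨h1, h2⟩)
      · rw [Fin.ext h]
        exact ⟨ha, Nat.lt_succ_self _⟩
      · exact ⟨h1, by omega⟩
  rw [countLt, this, Finset.card_insert_of_notMem (by simp), countLt]

lemma countLt_succ_of_notMem {A : Finset (Fin (2 * N))} {a : Fin (2 * N)} (ha : a ∉ A) :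
    countLt A (a + 1) = countLt A a := by
  rw [countLt, countLt]
  congr 1
  ext b
  simp only [Finset.mem_filter, and_congr_right_iff]
  intro hb
  have : (b : ℕ) ≠ a := fun h => ha (Fin.ext h ▸ hb)
  omega

lemma countLt_of_le (A : Finset (Fin (2 * N))) {t : ℕ} (ht : 2 * N ≤ t) :
    countLt A t = A.card := by
  rw [countLt, Finset.filter_true_of_mem fun a _ => a.2.trans_le ht]

lemma countLt_mono (A : Finset (Fin (2 * N))) : Monotone (countLt A) := fun _ _ h =>
  Finset.card_le_card fun _ ha => by
    rw [Finset.mem_filter] at ha ⊢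
    exact ⟨ha.1, ha.2.trans_le h⟩

/-- A link pattern with prescribed left endpoints exists as soon as the ballot condition
holds. -/
theorem exists_isLP_of_ballot (A : Finset (Fin (2 * N))) (hA : A.card = N)
    (hpos : ∀ t, t ≤ 2 * N → t ≤ 2 * countLt A t) :
    ∃ β, isLP N β ∧ Finset.univ.image β.1 = A := by
  let h : ℕ → ℤ := fun t => 2 * (countLt A t : ℤ) - t
  have hmem : ∀ a ∈ A, h (a + 1) = h a + 1 := by
    intro a ha
    simp only [h, countLt_succ_of_mem ha]
    push_cast
    ring
  have hnot : ∀ a ∉ A, h (a + 1) = h a - 1 := by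
    intro a ha
    simp only [h, countLt_succ_of_notMem ha]
    push_cast
    ring
  have hnonneg : ∀ t, t ≤ 2 * N → 0 ≤ h t := by
    intro t ht
    have := hpos t ht
    simp only [h]
    omega
  have hend : h (2 * N) = 0 := by
    simp only [h, countLt_of_le A le_rfl, hA]
    push_cast
    ring
  have hpartner : ∀ a ∈ A, ∃ b : Fin (2 * N), a < b ∧ b ∉ A ∧ h (b + 1) = h a ∧
      ∀ u : ℕ, a < u → u ≤ b → h a < h u := by
    intro a ha
    have hex : ∃ t, (a : ℕ) < t ∧ h (t + 1) ≤ h a := by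
      refine ⟨2 * N - 1, ?_, ?_⟩
      · have h1 := hmem a ha
        have h2 := hnonneg a a.2.le
        have h3 := a.2
        by_contra hlt
        have h4 : (a : ℕ) + 1 = 2 * N := by omega
        rw [h4, hend] at h1
        omega
      · have h3 := a.2
        rw [Nat.sub_add_cancel (by omega), hend]
        exact hnonneg a a.2.le
    have hfind := Nat.find_spec hex
    have hmin := fun t (ht : t < Nat.find hex) => Nat.find_min hex ht
    set b := Nat.find hex with hb
    have hgt : ∀ u : ℕ, a < u → u ≤ b → h a < h u := by
      intro u hu hub
      obtain ⟨t, rfl⟩ := Nat.exists_eq_add_of_lt hu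
      rcases Nat.eq_zero_or_pos t with rfl | ht
      · rw [add_zero, hmem a ha]
        exact lt_add_one _
      · have := hmin (a + t) (by omega)
        push Not at this
        exact this (by omega)
    have hb2 : b < 2 * N := by
      by_contra hle
      have h1 := hgt (2 * N) a.2 (by omega)
      rw [hend] at h1
      have h2 := hnonneg a a.2.le
      omega
    have hlt := hgt b hfind.1 le_rfl
    have hbA : (⟨b, hb2⟩ : Fin (2 * N)) ∉ A := by
      intro hbA
      have h1 := hmem _ hbA
      have h2 := hfind.2
      simp only at h1
      omega
    refine ⟨⟨b, hb2⟩, hfind.1, hbA, ?_, hgt⟩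
    have h1 := hnot _ hbA
    have h2 := hfind.2
    simp only at h1 ⊢
    omega
  choose! b hab hbA hbh hbu using hpartner
  have hbinj : ∀ a ∈ A, ∀ a' ∈ A, a < a' → b a ≠ b a' := by
    intro a ha a' ha' hlt he
    have h1 := hbu a ha a' hlt (by rw [he]; exact (hab a' ha').le)
    rw [← hbh a ha, ← hbh a' ha', he] at h1
    exact lt_irrefl _ h1
  let o := A.orderEmbOfFin hA
  have ho : ∀ k, o k ∈ A := A.orderEmbOfFin_mem hA
  refine ⟨(o, fun k => b (o k)), ⟨fun k l hkl => o.strictMono hkl, fun k => hab _ (ho k), ?_, ?_⟩,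
    ?_⟩
  · refine (Fintype.bijective_iff_injective_and_card _).2 ⟨?_, by simp [two_mul]⟩
    refine Function.Injective.sumElim o.injective ?_ ?_
    · intro k l hkl
      rcases lt_trichotomy k l with hlt | rfl | hlt
      · exact absurd hkl (hbinj _ (ho k) _ (ho l) (o.strictMono hlt))
      · rfl
      · exact absurd hkl.symm (hbinj _ (ho l) _ (ho k) (o.strictMono hlt))
    · intro k l hkl
      have : o k = b (o l) := hkl
      exact hbA _ (ho l) (this ▸ ho k)
  · rintro k l ⟨h1, h2, h3⟩
    have e1 := hbu _ (ho k) (o l) h1 (le_of_lt h2)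
    have e2 := hbu _ (ho l) (b (o k) + 1) (Nat.lt_succ_of_lt h2) h3
    rw [hbh _ (ho k)] at e2
    omega
  · ext a
    have : a ∈ Set.range o ↔ a ∈ (A : Set (Fin (2 * N))) := by rw [A.range_orderEmbOfFin hA]
    simpa using this

lemma isLP.eq_snd {β β' : (Fin N → Fin (2 * N)) × (Fin N → Fin (2 * N))} (h : isLP N β)
    (h' : isLP N β') (he : β.1 = β'.1) : β.2 = β'.2 := by
  have key : ∀ γ γ' : (Fin N → Fin (2 * N)) × (Fin N → Fin (2 * N)), isLP N γ → isLP N γ' →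
      γ.1 = γ'.1 → ∀ k, (∀ l, k < l → γ.2 l = γ'.2 l) → ¬ γ.2 k < γ'.2 k := by
    intro γ γ' hγ hγ' hγe k hk hlt
    obtain ⟨t, ht⟩ := hγ'.2.2.1.2 (γ.2 k)
    rcases t with l | l
    · rw [Sum.elim_inl, ← hγe] at ht
      have := hγ.2.2.1.1 (a₁ := Sum.inl l) (a₂ := Sum.inr k) ht
      cases this
    · rw [Sum.elim_inr] at ht
      rcases lt_trichotomy l k with hlk | rfl | hkl
      · refine hγ'.2.2.2 l k ⟨hγ'.1 l k hlk, ?_, ?_⟩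
        · rw [ht, ← hγe]
          exact hγ.2.1 k
        · rwa [ht]
      · exact hlt.ne ht.symm
      · rw [← hk l hkl] at ht
        have := hγ.2.2.1.1 (a₁ := Sum.inr l) (a₂ := Sum.inr k) ht
        exact hkl.ne' (Sum.inr_injective this)
  funext k
  induction k using WellFoundedGT.induction with
  | ind k ih =>
    refine le_antisymm (not_lt.1 (key β' β h' h he.symm k fun l hl => (ih l hl).symm))
      (not_lt.1 (key β β' h h' he k ih))

lemma isLP.ext {β β' : (Fin N → Fin (2 * N)) × (Fin N → Fin (2 * N))} (h : isLP N β)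
    (h' : isLP N β') (he : Set.range β.1 = Set.range β'.1) : β = β' := by
  have h1 : β.1 = β'.1 :=
    (StrictMono.range_inj (fun k l hkl => h.1 k l hkl) (fun k l hkl => h'.1 k l hkl)).1 he
  exact Prod.ext h1 (h.eq_snd h' h1)

end Ballot

section Groups

variable {d : ℕ} {s : ℕ → ℕ}

lemma q_mono (s : ℕ → ℕ) : Monotone (q s) := fun _ _ h =>
  Finset.sum_le_sum_of_subset (Finset.range_mono h)

lemma q_succ (s : ℕ → ℕ) (j : ℕ) : q s (j + 1) = q s j + s j := Finset.sum_range_succ _ _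

lemma grp_mono (d : ℕ) (s : ℕ → ℕ) : Monotone (grp d s) := fun _ _ h =>
  Finset.card_le_card (Finset.monotone_filter_right _ fun _ _ hj => le_trans hj h)

lemma grp_eq {j t : ℕ} (hj : j < d) (h1 : q s j ≤ t) (h2 : t < q s (j + 1)) :
    grp d s t = j := by
  have : (Finset.range d).filter (fun i => q s (i + 1) ≤ t) = Finset.range j := by
    ext i
    simp only [Finset.mem_filter, Finset.mem_range]
    constructor
    · rintro ⟨_, hi⟩
      by_contra hlt
      exact absurd (h2.trans_le (q_mono s (show j + 1 ≤ i + 1 by omega))) (not_lt.2 hi)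
    · intro hi
      exact ⟨hi.trans hj, (q_mono s (show i + 1 ≤ j by omega)).trans h1⟩
  rw [grp, this, Finset.card_range]

lemma exists_group (d : ℕ) (s : ℕ → ℕ) (t : ℕ) (ht : t < q s d) :
    ∃ j, j < d ∧ q s j ≤ t ∧ t < q s (j + 1) := by
  induction d with
  | zero => simp [q] at ht
  | succ d ih =>
    rcases lt_or_ge t (q s d) with h | h
    · obtain ⟨j, hj, h⟩ := ih h
      exact ⟨j, by omega, h⟩
    · exact ⟨d, by omega, h, ht⟩

lemma grp_lt {t : ℕ} (ht : t < q s d) : grp d s t < d := by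
  obtain ⟨j, hj, h1, h2⟩ := exists_group d s t ht
  rwa [grp_eq hj h1 h2]

lemma q_grp_le {t : ℕ} (ht : t < q s d) : q s (grp d s t) ≤ t := by
  obtain ⟨j, hj, h1, h2⟩ := exists_group d s t ht
  rwa [grp_eq hj h1 h2]

lemma lt_q_grp_succ {t : ℕ} (ht : t < q s d) : t < q s (grp d s t + 1) := by
  obtain ⟨j, hj, h1, h2⟩ := exists_group d s t ht
  rwa [grp_eq hj h1 h2]

lemma off_lt {t : ℕ} (ht : t < q s d) : off d s t < s (grp d s t) := by
  have h1 := q_grp_le ht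
  have h2 := lt_q_grp_succ ht
  rw [q_succ] at h2
  rw [off]
  omega

lemma grp_q_add {j i : ℕ} (hj : j < d) (hi : i < s j) : grp d s (q s j + i) = j :=
  grp_eq hj (Nat.le_add_right _ _) (by rw [q_succ]; omega)

lemma off_q_add {j i : ℕ} (hj : j < d) (hi : i < s j) : off d s (q s j + i) = i := by
  rw [off, grp_q_add hj hi, Nat.add_sub_cancel_left]

lemma q_add_off {t : ℕ} (ht : t < q s d) : q s (grp d s t) + off d s t = t := by
  have := q_grp_le ht
  rw [off]
  omega

end Groups

section Patterns

variable {N d : ℕ} {s : ℕ → ℕ}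

/-- The number of elements of `A` in the `i`-th group. -/
noncomputable def countGrp (d : ℕ) (s : ℕ → ℕ) (A : Finset (Fin (2 * N))) (i : ℕ) : ℕ :=
  (A.filter fun a : Fin (2 * N) => grp d s a = i).card

/-- The left endpoints of a link pattern. -/
noncomputable def opens (β : (Fin N → Fin (2 * N)) × (Fin N → Fin (2 * N))) :
    Finset (Fin (2 * N)) := Finset.univ.image β.1

lemma isLP.injective_fst {β : (Fin N → Fin (2 * N)) × (Fin N → Fin (2 * N))} (h : isLP N β) :
    Function.Injective β.1 :=
  StrictMono.injective fun k l hkl => h.1 k l hkl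

lemma isLP.card_filter_opens {β : (Fin N → Fin (2 * N)) × (Fin N → Fin (2 * N))}
    (h : isLP N β) (P : Fin (2 * N) → Prop) [DecidablePred P] :
    ((opens β).filter P).card = (Finset.univ.filter fun k => P (β.1 k)).card := by
  rw [opens, Finset.filter_image, Finset.card_image_of_injective _ h.injective_fst]

lemma isLP.card_opens {β : (Fin N → Fin (2 * N)) × (Fin N → Fin (2 * N))} (h : isLP N β) :
    (opens β).card = N := by
  rw [opens, Finset.card_image_of_injective _ h.injective_fst, Finset.card_univ,
    Fintype.card_fin]

lemma isLP.path_eq {β : (Fin N → Fin (2 * N)) × (Fin N → Fin (2 * N))} (h : isLP N β)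
    {t : ℕ} (ht : t ≤ 2 * N) : path N β t = 2 * (countLt (opens β) t : ℤ) - t := by
  have h1 := (Equiv.ofBijective _ h.2.2.1).sum_comp
    fun u : Fin (2 * N) => if (u : ℕ) < t then 1 else 0
  rw [Fintype.sum_sum_type, Fin.sum_univ_eq_sum_range (fun u => if u < t then 1 else 0)] at h1
  simp only [Equiv.ofBijective_apply, Sum.elim_inl, Sum.elim_inr] at h1
  rw [← Finset.card_filter, ← Finset.card_filter, ← Finset.card_filter,
    show (Finset.range (2 * N)).filter (fun u => u < t) = Finset.range t by
      ext u; simp only [Finset.mem_filter, Finset.mem_range]; omega, Finset.card_range] at h1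
  rw [path, countLt, h.card_filter_opens]
  omega

lemma isLP.le_two_mul_countLt {β : (Fin N → Fin (2 * N)) × (Fin N → Fin (2 * N))}
    (h : isLP N β) {t : ℕ} (ht : t ≤ 2 * N) : t ≤ 2 * countLt (opens β) t := by
  have h1 := h.path_eq ht
  have h2 : (Finset.univ.filter fun k : Fin N => (β.2 k : ℕ) < t).card ≤
      (Finset.univ.filter fun k : Fin N => (β.1 k : ℕ) < t).card :=
    Finset.card_le_card (Finset.monotone_filter_right _ fun k _ hk =>
      (Fin.lt_def.1 (h.2.1 k)).trans hk)
  rw [path] at h1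
  omega

lemma countLt_q_succ (hsum : q s d = 2 * N) (A : Finset (Fin (2 * N))) {j : ℕ} (hj : j < d) :
    countLt A (q s (j + 1)) = countLt A (q s j) + countGrp d s A j := by
  rw [countLt, countLt, countGrp, Finset.card_filter, Finset.card_filter, Finset.card_filter,
    ← Finset.sum_add_distrib]
  refine Finset.sum_congr rfl fun a _ => ?_
  have ha : (a : ℕ) < q s d := by rw [hsum]; exact a.2
  have hq := q_mono s (Nat.le_succ j)
  by_cases h1 : (a : ℕ) < q s j
  · have h2 : grp d s a ≠ j := by
      rintro rfl
      exact absurd (q_grp_le ha) (not_le.2 h1)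
    rw [if_pos (h1.trans_le hq), if_pos h1, if_neg h2]
  · by_cases h2 : (a : ℕ) < q s (j + 1)
    · rw [if_pos h2, if_neg h1, if_pos (grp_eq hj (not_lt.1 h1) h2)]
    · have h3 : grp d s a ≠ j := by
        rintro rfl
        exact h2 (lt_q_grp_succ ha)
      rw [if_neg h2, if_neg h1, if_neg h3]

lemma countLt_q_eq_iff (hsum : q s d = 2 * N) (A B : Finset (Fin (2 * N))) :
    (∀ j, j ≤ d → countLt A (q s j) = countLt B (q s j)) ↔
      ∀ j, j < d → countGrp d s A j = countGrp d s B j := by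
  constructor
  · intro h j hj
    have h1 := h (j + 1) hj
    rw [countLt_q_succ hsum A hj, countLt_q_succ hsum B hj, h j hj.le] at h1
    exact Nat.add_left_cancel h1
  · intro h j
    induction j with
    | zero => intro _; simp [q, countLt]
    | succ j ih =>
      intro hj
      rw [countLt_q_succ hsum A hj, countLt_q_succ hsum B hj, ih (by omega), h j hj]

lemma countLt_add_le (A : Finset (Fin (2 * N))) (t n : ℕ) (h : t + n ≤ 2 * N) :
    countLt A (t + n) ≤ countLt A t + n := by
  induction n with
  | zero => rfl
  | succ n ih =>
    have h1 := ih (by omega)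
    by_cases ha : (⟨t + n, by omega⟩ : Fin (2 * N)) ∈ A
    · have h2 := countLt_succ_of_mem ha
      simp only at h2
      rw [← add_assoc]
      omega
    · have h2 := countLt_succ_of_notMem ha
      simp only at h2
      rw [← add_assoc]
      omega

lemma countLt_add_of_mem (A : Finset (Fin (2 * N))) (t n : ℕ) (h : t + n ≤ 2 * N)
    (hA : ∀ u : Fin (2 * N), t ≤ u → u < t + n → u ∈ A) :
    countLt A (t + n) = countLt A t + n := by
  induction n with
  | zero => rfl
  | succ n ih =>
    have h2 := countLt_succ_of_mem (hA ⟨t + n, by omega⟩ (by simp) (by simp))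
    simp only at h2
    rw [← add_assoc, h2, ih (by omega) fun u h1 h3 => hA u h1 (by omega), add_assoc]

lemma valenced.mem_opens_of_lt {α : (Fin N → Fin (2 * N)) × (Fin N → Fin (2 * N))}
    (hα : valenced N d s α) {u v : Fin (2 * N)} (hu : u ∈ opens α) (huv : u < v)
    (hg : grp d s u = grp d s v) : v ∈ opens α := by
  by_contra hv
  obtain ⟨k, -, rfl⟩ := Finset.mem_image.1 hu
  obtain ⟨x, rfl⟩ := hα.1.2.2.1.2 v
  rcases x with l | l
  · exact hv (Finset.mem_image_of_mem _ (Finset.mem_univ l))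
  · simp only [Sum.elim_inr] at hv huv hg
    refine hα.1.2.2.2 l k ⟨?_, huv, ?_⟩
    · by_contra hle
      refine hα.2 l (le_antisymm (grp_mono d s (Fin.le_def.1 (hα.1.2.1 l).le)) ?_)
      rw [← hg]
      exact grp_mono d s (Fin.le_def.1 (not_lt.1 hle))
    · by_contra hle
      refine hα.2 k (le_antisymm (grp_mono d s (Fin.le_def.1 (hα.1.2.1 k).le)) ?_)
      rw [hg]
      exact grp_mono d s (Fin.le_def.1 (not_lt.1 hle))

/-- The Dyck path of a valenced link pattern is minimal. -/
lemma valenced.countLt_le (hsum : q s d = 2 * N)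
    {α : (Fin N → Fin (2 * N)) × (Fin N → Fin (2 * N))} (hα : valenced N d s α)
    {A : Finset (Fin (2 * N))} (hA : ∀ j, j < d → countGrp d s A j = countGrp d s (opens α) j)
    {t : ℕ} (ht : t ≤ 2 * N) : countLt (opens α) t ≤ countLt A t := by
  have hq := (countLt_q_eq_iff hsum A (opens α)).2 hA
  rcases ht.eq_or_lt with rfl | ht
  · rw [← hsum, hq d le_rfl]
  · have ht' : t < q s d := hsum ▸ ht
    have hj := grp_lt ht'
    have h1 := q_grp_le ht'
    have h2 := lt_q_grp_succ ht'
    set j := grp d s t with hjdef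
    have hq2 : q s (j + 1) ≤ 2 * N := hsum ▸ q_mono s hj
    by_cases hex : ∃ u ∈ opens α, q s j ≤ (u : ℕ) ∧ (u : ℕ) < t
    · obtain ⟨u, hu, hu1, hu2⟩ := hex
      obtain ⟨n, hn⟩ := Nat.exists_eq_add_of_le h2.le
      have h3 := countLt_add_le A t n (by omega)
      have h4 := countLt_add_of_mem (opens α) t n (by omega) (by
        intro v hv1 hv2
        refine hα.mem_opens_of_lt hu (Fin.lt_def.2 (hu2.trans_le hv1)) ?_
        rw [grp_eq hj hu1 (by omega), grp_eq hj (by omega) (by omega)])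
      have h5 := hq (j + 1) hj
      rw [hn] at h5
      omega
    · push Not at hex
      have : countLt (opens α) t = countLt (opens α) (q s j) := by
        rw [countLt, countLt]
        congr 1
        ext u
        simp only [Finset.mem_filter, and_congr_right_iff]
        intro hu
        have := hex u hu
        omega
      rw [this, ← hq j hj.le]
      exact countLt_mono A h1

lemma valenced.geqVal_iff (hsum : q s d = 2 * N)
    {α β : (Fin N → Fin (2 * N)) × (Fin N → Fin (2 * N))} (hα : valenced N d s α)
    (hβ : isLP N β) : geqVal N d s β α ↔
      ∀ j, j < d → countGrp d s (opens β) j = countGrp d s (opens α) j := by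
  have hq : ∀ j, j ≤ d → q s j ≤ 2 * N := fun j hj => hsum ▸ q_mono s hj
  rw [← countLt_q_eq_iff hsum]
  constructor
  · rintro ⟨-, h⟩ j hj
    have := h j hj
    rw [hβ.path_eq (hq j hj), hα.1.path_eq (hq j hj)] at this
    omega
  · intro h
    refine ⟨fun t ht => ?_, fun j hj => ?_⟩
    · rw [hβ.path_eq ht, hα.1.path_eq ht]
      have := hα.countLt_le hsum ((countLt_q_eq_iff hsum _ _).1 h) ht
      omega
    · rw [hβ.path_eq (hq j hj), hα.1.path_eq (hq j hj), h j hj]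

/-- Every set of positions with the same group counts as `α` is the set of left endpoints of
a link pattern. -/
theorem valenced.exists_isLP (hsum : q s d = 2 * N)
    {α : (Fin N → Fin (2 * N)) × (Fin N → Fin (2 * N))} (hα : valenced N d s α)
    {A : Finset (Fin (2 * N))} (hA : ∀ j, j < d → countGrp d s A j = countGrp d s (opens α) j) :
    ∃ β, isLP N β ∧ opens β = A := by
  refine exists_isLP_of_ballot A ?_ fun t ht => ?_
  · have h := (countLt_q_eq_iff hsum A (opens α)).2 hA d le_rfl
    rwa [hsum, countLt_of_le _ le_rfl, countLt_of_le _ le_rfl, hα.1.card_opens] at h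
  · have h1 := hα.countLt_le hsum hA ht
    have h2 := hα.1.le_two_mul_countLt ht
    omega

end Patterns

section Sign

variable {N : ℕ}

/-- The other element of a block `{2 k, 2 k + 1}`. -/
def blockSwap (j : Fin (2 * N)) : Fin (2 * N) :=
  ⟨if (j : ℕ) % 2 = 0 then j + 1 else j - 1, by have := j.2; split_ifs <;> omega⟩

lemma blockSwap_val (j : Fin (2 * N)) :
    (blockSwap j : ℕ) = if (j : ℕ) % 2 = 0 then (j : ℕ) + 1 else j - 1 := rfl

lemma blockSwap_div (j : Fin (2 * N)) : (blockSwap j : ℕ) / 2 = (j : ℕ) / 2 := by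
  rw [blockSwap_val]
  split_ifs <;> omega

lemma blockSwap_blockSwap (j : Fin (2 * N)) : blockSwap (blockSwap j) = j := by
  refine Fin.ext ?_
  rw [blockSwap_val, blockSwap_val]
  split_ifs <;> omega

lemma sign_eq_one_of_blocks (ρ : Equiv.Perm (Fin (2 * N)))
    (h1 : ∀ i j : Fin (2 * N), i < j → (i : ℕ) / 2 = j / 2 → ρ i < ρ j)
    (h2 : ∀ i j : Fin (2 * N), (i : ℕ) / 2 < j / 2 → (ρ i < ρ j ↔ ρ i < ρ (blockSwap j))) :
    Equiv.Perm.sign ρ = 1 := by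
  rw [Equiv.Perm.sign_eq_prod_prod_Ioi]
  refine Finset.prod_eq_one fun i _ => ?_
  refine Finset.prod_involution
    (fun j _ => if (i : ℕ) / 2 = j / 2 then j else blockSwap j) ?_ ?_ ?_ ?_
  · intro j hj
    have hij := Finset.mem_Ioi.1 hj
    rw [Fin.lt_def] at hij
    by_cases h : (i : ℕ) / 2 = j / 2
    · simp only [h, if_true]
      split_ifs <;> simp
    · simp only [if_neg h, h2 i j (by omega)]
      split_ifs <;> simp
  · intro j hj hne
    have hij := Finset.mem_Ioi.1 hj
    by_cases h : (i : ℕ) / 2 = j / 2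
    · exact absurd (if_pos (h1 i j hij h)) hne
    · rw [if_neg h]
      intro he
      have := congrArg Fin.val he
      rw [blockSwap_val] at this
      split_ifs at this <;> omega
  · intro j hj
    have hij := Finset.mem_Ioi.1 hj
    split_ifs with h
    · exact hj
    · rw [Finset.mem_Ioi, Fin.lt_def]
      have := blockSwap_div j
      rw [Fin.lt_def] at hij
      omega
  · intro j hj
    by_cases h : (i : ℕ) / 2 = j / 2
    · simp only [h, if_true]
    · simp only [h, if_false, blockSwap_div, blockSwap_blockSwap]

/-- The bijection from link ends to `Fin (2 * N)` listing the links one after the other. -/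
noncomputable def stdEquiv (N : ℕ) : Fin N ⊕ Fin N ≃ Fin (2 * N) :=
  Equiv.ofBijective (Sum.elim (fun k => ⟨2 * k, by omega⟩) fun k => ⟨2 * k + 1, by omega⟩) (by
    refine (Fintype.bijective_iff_injective_and_card _).2 ⟨?_, by simp [two_mul]⟩
    refine Function.Injective.sumElim ?_ ?_ ?_
    · intro k l h
      simp only [Fin.mk.injEq] at h
      exact Fin.ext (by omega)
    · intro k l h
      simp only [Fin.mk.injEq] at h
      exact Fin.ext (by omega)
    · intro k l h
      simp only [Fin.mk.injEq] at h
      omega)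

lemma stdEquiv_inl (k : Fin N) : (stdEquiv N (Sum.inl k) : ℕ) = 2 * k := rfl

lemma stdEquiv_inr (k : Fin N) : (stdEquiv N (Sum.inr k) : ℕ) = 2 * k + 1 := rfl

lemma blockSwap_stdEquiv_inl (k : Fin N) :
    blockSwap (stdEquiv N (Sum.inl k)) = stdEquiv N (Sum.inr k) := by
  refine Fin.ext ?_
  rw [blockSwap_val, stdEquiv_inl, stdEquiv_inr, if_pos (by omega)]

lemma blockSwap_stdEquiv_inr (k : Fin N) :
    blockSwap (stdEquiv N (Sum.inr k)) = stdEquiv N (Sum.inl k) := by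
  rw [← blockSwap_stdEquiv_inl, blockSwap_blockSwap]

/-- The bijection from link ends to positions of a link pattern. -/
noncomputable def linkEquiv {β : (Fin N → Fin (2 * N)) × (Fin N → Fin (2 * N))}
    (h : isLP N β) : Fin N ⊕ Fin N ≃ Fin (2 * N) :=
  Equiv.ofBijective _ h.2.2.1

lemma linkEquiv_inl {β : (Fin N → Fin (2 * N)) × (Fin N → Fin (2 * N))} (h : isLP N β)
    (k : Fin N) : linkEquiv h (Sum.inl k) = β.1 k := rfl

lemma linkEquiv_inr {β : (Fin N → Fin (2 * N)) × (Fin N → Fin (2 * N))} (h : isLP N β)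
    (k : Fin N) : linkEquiv h (Sum.inr k) = β.2 k := rfl

lemma sign_stdEquiv_symm_trans_linkEquiv
    {β : (Fin N → Fin (2 * N)) × (Fin N → Fin (2 * N))} (h : isLP N β) :
    Equiv.Perm.sign ((stdEquiv N).symm.trans (linkEquiv h)) = 1 := by
  have hcross : ∀ k l, k < l → (β.2 k < β.1 l ↔ β.2 k < β.2 l) := by
    intro k l hkl
    refine ⟨fun h' => h'.trans (h.2.1 l), fun h' => ?_⟩
    have hne : β.2 k ≠ β.1 l := by
      intro e
      have := h.2.2.1.1 (a₁ := Sum.inr k) (a₂ := Sum.inl l) e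
      cases this
    refine lt_of_le_of_ne (not_lt.1 fun h'' => ?_) hne
    exact h.2.2.2 k l ⟨h.1 k l hkl, h'', h'⟩
  refine sign_eq_one_of_blocks _ ?_ ?_
  · intro i j hij hb
    obtain ⟨x, rfl⟩ := (stdEquiv N).surjective i
    obtain ⟨y, rfl⟩ := (stdEquiv N).surjective j
    rw [Fin.lt_def] at hij
    rcases x with k | k <;> rcases y with l | l <;>
      simp only [stdEquiv_inl, stdEquiv_inr] at hij hb
    · omega
    · obtain rfl : k = l := Fin.ext (by omega)
      simpa [linkEquiv_inl, linkEquiv_inr] using h.2.1 k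
    · omega
    · omega
  · intro i j hij
    obtain ⟨x, rfl⟩ := (stdEquiv N).surjective i
    obtain ⟨y, rfl⟩ := (stdEquiv N).surjective j
    rcases x with k | k <;> rcases y with l | l <;>
      simp only [stdEquiv_inl, stdEquiv_inr] at hij <;>
      have hkl : k < l := Fin.lt_def.2 (by omega) <;>
      simp only [blockSwap_stdEquiv_inl, blockSwap_stdEquiv_inr, Equiv.trans_apply,
        Equiv.symm_apply_apply, linkEquiv_inl, linkEquiv_inr]
    · exact iff_of_true (h.1 k l hkl) ((h.1 k l hkl).trans (h.2.1 l))
    · exact iff_of_true ((h.1 k l hkl).trans (h.2.1 l)) (h.1 k l hkl)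
    · exact hcross k l hkl
    · exact (hcross k l hkl).symm

/-- The link pattern permutations are even relative to each other. -/
theorem sign_linkEquiv_trans_symm {α β : (Fin N → Fin (2 * N)) × (Fin N → Fin (2 * N))}
    (hα : isLP N α) (hβ : isLP N β) :
    Equiv.Perm.sign ((linkEquiv hβ).trans (linkEquiv hα).symm) = 1 := by
  have h1 := sign_stdEquiv_symm_trans_linkEquiv hα
  have h2 := sign_stdEquiv_symm_trans_linkEquiv hβ
  have h3 : (linkEquiv hβ).trans (linkEquiv hα).symm =
      ((stdEquiv N).trans (((stdEquiv N).symm.trans (linkEquiv hβ)).trans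
        ((stdEquiv N).symm.trans (linkEquiv hα)).symm)).trans (stdEquiv N).symm := by
    ext x
    simp
  rw [h3, Equiv.Perm.sign_trans_trans_symm, Equiv.Perm.sign_trans, Equiv.Perm.sign_symm, h1, h2,
    one_mul]

end Sign

section SkewExpansion

variable {A : Type*} [CommRing A] [Algebra ℝ A] {K : Type*} [Fintype K] [DecidableEq K]

lemma sum_sign_smul_prod_insert (κ : K ⊕ K → K ⊕ K → A) (hκ : ∀ u v, κ u v = κ v u)
    (z : K ⊕ K → ℝ) (C : Finset K) (c : K) (hc : c ∉ C) :
    ∑ σ : Equiv.Perm (K ⊕ K), Equiv.Perm.sign σ • ∏ k,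
        (if k ∈ insert c C then 2 * z (σ (Sum.inl k)) else
          z (σ (Sum.inl k)) - z (σ (Sum.inr k))) • κ (σ (Sum.inl k)) (σ (Sum.inr k)) =
      ∑ σ : Equiv.Perm (K ⊕ K), Equiv.Perm.sign σ • ∏ k,
        (if k ∈ C then 2 * z (σ (Sum.inl k)) else
          z (σ (Sum.inl k)) - z (σ (Sum.inr k))) • κ (σ (Sum.inl k)) (σ (Sum.inr k)) := by
  rw [← sub_eq_zero, ← Finset.sum_sub_distrib]
  let rest : Equiv.Perm (K ⊕ K) → A := fun σ => ∏ k ∈ Finset.univ.erase c,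
    (if k ∈ C then 2 * z (σ (Sum.inl k)) else
      z (σ (Sum.inl k)) - z (σ (Sum.inr k))) • κ (σ (Sum.inl k)) (σ (Sum.inr k))
  have hterm : ∀ σ : Equiv.Perm (K ⊕ K), Equiv.Perm.sign σ • ∏ k,
        (if k ∈ insert c C then 2 * z (σ (Sum.inl k)) else
          z (σ (Sum.inl k)) - z (σ (Sum.inr k))) • κ (σ (Sum.inl k)) (σ (Sum.inr k)) -
      Equiv.Perm.sign σ • ∏ k,
        (if k ∈ C then 2 * z (σ (Sum.inl k)) else
          z (σ (Sum.inl k)) - z (σ (Sum.inr k))) • κ (σ (Sum.inl k)) (σ (Sum.inr k)) =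
      Equiv.Perm.sign σ • ((z (σ (Sum.inl c)) + z (σ (Sum.inr c))) •
        κ (σ (Sum.inl c)) (σ (Sum.inr c)) * rest σ) := by
    intro σ
    rw [← Finset.mul_prod_erase _ _ (Finset.mem_univ c),
      ← Finset.mul_prod_erase Finset.univ (fun k => (if k ∈ C then _ else _ : ℝ) • _)
        (Finset.mem_univ c), if_pos (Finset.mem_insert_self c C), if_neg hc, ← smul_sub]
    congr 1
    rw [show ∏ k ∈ Finset.univ.erase c, (if k ∈ insert c C then 2 * z (σ (Sum.inl k)) else
      z (σ (Sum.inl k)) - z (σ (Sum.inr k))) • κ (σ (Sum.inl k)) (σ (Sum.inr k)) = rest σ from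
      Finset.prod_congr rfl fun k hk => by
        simp only [Finset.mem_insert, Finset.ne_of_mem_erase hk, false_or]]
    rw [← sub_mul, ← sub_smul]
    congr 3
    ring
  rw [Finset.sum_congr rfl fun σ _ => hterm σ]
  refine Finset.sum_involution
    (fun σ _ => (Equiv.swap (Sum.inl c) (Sum.inr c)).trans σ) ?_ ?_ ?_ ?_
  · intro σ _
    have hrest : rest ((Equiv.swap (Sum.inl c) (Sum.inr c)).trans σ) = rest σ := by
      refine Finset.prod_congr rfl fun k hk => ?_
      have hk := Finset.ne_of_mem_erase hk
      simp only [Equiv.trans_apply]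
      rw [Equiv.swap_apply_of_ne_of_ne (a := Sum.inl c) (x := Sum.inl k) (by simp [hk]) (by simp),
        Equiv.swap_apply_of_ne_of_ne (a := Sum.inl c) (x := Sum.inr k) (by simp) (by simp [hk])]
    rw [hrest, Equiv.Perm.sign_trans, Equiv.Perm.sign_swap (by simp), mul_neg, mul_one]
    simp only [Equiv.trans_apply, Equiv.swap_apply_left, Equiv.swap_apply_right]
    rw [hκ (σ (Sum.inr c)), add_comm (z (σ (Sum.inr c))), Units.neg_smul, add_neg_cancel]
  · intro σ _ _ h
    have := congrArg (fun e : Equiv.Perm (K ⊕ K) => e (Sum.inl c)) h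
    simp at this
  · intro σ _
    exact Finset.mem_univ _
  · intro σ _
    ext x
    simp

/-- For a symmetric kernel, the skew factors may be replaced by the first parameters. -/
lemma sum_sign_smul_prod_sub (κ : K ⊕ K → K ⊕ K → A) (hκ : ∀ u v, κ u v = κ v u)
    (z : K ⊕ K → ℝ) :
    ∑ σ : Equiv.Perm (K ⊕ K), Equiv.Perm.sign σ • ∏ k,
        (z (σ (Sum.inl k)) - z (σ (Sum.inr k))) • κ (σ (Sum.inl k)) (σ (Sum.inr k)) =
      (2 : ℝ) ^ Fintype.card K • ∑ σ : Equiv.Perm (K ⊕ K), (∏ k, z (σ (Sum.inl k))) •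
        Equiv.Perm.sign σ • ∏ k, κ (σ (Sum.inl k)) (σ (Sum.inr k)) := by
  have h : ∀ C : Finset K, ∑ σ : Equiv.Perm (K ⊕ K), Equiv.Perm.sign σ • ∏ k,
        (if k ∈ C then 2 * z (σ (Sum.inl k)) else
          z (σ (Sum.inl k)) - z (σ (Sum.inr k))) • κ (σ (Sum.inl k)) (σ (Sum.inr k)) =
      ∑ σ : Equiv.Perm (K ⊕ K), Equiv.Perm.sign σ • ∏ k,
        (z (σ (Sum.inl k)) - z (σ (Sum.inr k))) • κ (σ (Sum.inl k)) (σ (Sum.inr k)) := by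
    intro C
    induction C using Finset.induction_on with
    | empty => simp
    | insert c C hc ih => rw [sum_sign_smul_prod_insert κ hκ z C c hc, ih]
  rw [← h Finset.univ, Finset.smul_sum]
  refine Finset.sum_congr rfl fun σ _ => ?_
  simp only [Finset.mem_univ, if_true]
  rw [Finset.prod_smul, Finset.prod_mul_distrib, Finset.prod_const, Finset.card_univ, mul_smul,
    smul_comm (Equiv.Perm.sign σ), smul_comm (Equiv.Perm.sign σ)]

omit [DecidableEq K] in
/-- A polynomial identity holds for each monomial separately. -/
lemma sum_filter_eq_zero_of_forall {ι σ : Type*} [Fintype ι] (a : ι → ℝ) (g : ι → K → σ)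
    (h : ∀ z : σ → ℝ, ∑ i, (∏ k, z (g i k)) * a i = 0) (n : σ →₀ ℕ) :
    ∑ i ∈ Finset.univ.filter (fun i => ∑ k, Finsupp.single (g i k) 1 = n), a i = 0 := by
  have hp : ∑ i, MvPolynomial.monomial (∑ k, Finsupp.single (g i k) 1) (a i) = 0 := by
    refine MvPolynomial.funext fun z => ?_
    rw [map_zero, map_sum, ← h z]
    refine Finset.sum_congr rfl fun i _ => ?_
    rw [← mul_one (a i), ← smul_eq_mul (a i), ← MvPolynomial.smul_monomial,
      MvPolynomial.monomial_sum_one, MvPolynomial.smul_eval, map_prod, smul_eq_mul, mul_comm]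
    simp [MvPolynomial.eval_monomial]
  have := congrArg (MvPolynomial.coeff n) hp
  rwa [MvPolynomial.coeff_sum, MvPolynomial.coeff_zero,
    Finset.sum_congr rfl (fun i _ => MvPolynomial.coeff_monomial _ _ _),
    ← Finset.sum_filter] at this

end SkewExpansion

section Determinants

variable {N d : ℕ} {s : ℕ → ℕ} {A : Type*} [CommRing A]

lemma sum_sign_mul_sign_smul_prod (M : Matrix (Fin N) (Fin N) A) :
    ∑ τ : Equiv.Perm (Fin N) × Equiv.Perm (Fin N),
        (Equiv.Perm.sign τ.1 * Equiv.Perm.sign τ.2) • ∏ k, M (τ.1 k) (τ.2 k) =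
      N.factorial • M.det := by
  rw [Fintype.sum_prod_type]
  have h : ∀ τ : Equiv.Perm (Fin N), ∑ τ' : Equiv.Perm (Fin N),
      (Equiv.Perm.sign τ * Equiv.Perm.sign τ') • ∏ k, M (τ k) (τ' k) = M.det := by
    intro τ
    have h1 := Matrix.det_permute τ M
    rw [← Matrix.det_transpose, Matrix.det_apply] at h1
    simp only [mul_smul, ← Finset.smul_sum]
    simp only [Matrix.transpose_apply, Matrix.submatrix_apply, id] at h1
    rw [h1, Units.smul_def, zsmul_eq_mul, ← mul_assoc, ← Int.cast_mul, ← Units.val_mul,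
      Int.units_mul_self, Units.val_one, Int.cast_one, one_mul]
  rw [Finset.sum_congr rfl fun τ _ => h τ, Finset.sum_const, Finset.card_univ,
    Fintype.card_perm, Fintype.card_fin]

lemma countGrp_image (f : Fin N → Fin (2 * N)) (hf : Function.Injective f) (i : ℕ) :
    countGrp d s (Finset.univ.image f) i =
      (Finset.univ.filter fun k => grp d s (f k) = i).card := by
  rw [countGrp, Finset.filter_image, Finset.card_image_of_injective _ hf]

/-- The alternating sum over the permutations with prescribed numbers of left ends in each
group is a sum of determinants over link patterns. -/
lemma valenced.sum_sign_smul_prod (hsum : q s d = 2 * N)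
    {α : (Fin N → Fin (2 * N)) × (Fin N → Fin (2 * N))} (hα : valenced N d s α)
    (κ : Fin (2 * N) → Fin (2 * N) → A) :
    ∑ σ ∈ Finset.univ.filter (fun σ : Equiv.Perm (Fin N ⊕ Fin N) => ∀ j, j < d →
        countGrp d s (Finset.univ.image fun k => linkEquiv hα.1 (σ (Sum.inl k))) j =
          countGrp d s (opens α) j),
      Equiv.Perm.sign σ • ∏ k, κ (linkEquiv hα.1 (σ (Sum.inl k)))
        (linkEquiv hα.1 (σ (Sum.inr k))) =
      N.factorial • ∑ β ∈ (LP N).filter (fun β => geqVal N d s β α),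
        (Matrix.of fun k l => κ (β.1 k) (β.2 l)).det := by
  rw [Finset.smul_sum, Finset.sum_congr rfl fun β _ => (sum_sign_mul_sign_smul_prod _).symm,
    ← Finset.sum_product']
  symm
  have hLP : ∀ {β}, β ∈ (LP N).filter (fun β => geqVal N d s β α) →
      isLP N β := fun h => (Finset.mem_filter.1 (Finset.mem_filter.1 h).1).2
  have hval : ∀ {β} (hβ : isLP N β) (τ : Equiv.Perm (Fin N) × Equiv.Perm (Fin N)) (x),
      linkEquiv hα.1 ((((Equiv.sumCongr τ.1 τ.2).trans (linkEquiv hβ)).trans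
        (linkEquiv hα.1).symm) x) = linkEquiv hβ (Equiv.sumCongr τ.1 τ.2 x) := by
    intro β hβ τ x
    simp
  refine Finset.sum_bij (fun p hp =>
    ((Equiv.sumCongr p.2.1 p.2.2).trans (linkEquiv (hLP (Finset.mem_product.1 hp).1))).trans
      (linkEquiv hα.1).symm) ?_ ?_ ?_ ?_
  · rintro ⟨β, τ⟩ hp
    have hβ := hLP (Finset.mem_product.1 hp).1
    rw [Finset.mem_filter]
    refine ⟨Finset.mem_univ _, ?_⟩
    have h := (hα.geqVal_iff hsum hβ).1 (Finset.mem_filter.1 (Finset.mem_product.1 hp).1).2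
    have himg : (Finset.univ.image fun k => linkEquiv hβ (Equiv.sumCongr τ.1 τ.2 (Sum.inl k))) =
        opens β := by
      ext a
      simp only [opens, Finset.mem_image, Finset.mem_univ, true_and]
      constructor
      · rintro ⟨k, rfl⟩
        exact ⟨τ.1 k, rfl⟩
      · rintro ⟨k, rfl⟩
        exact ⟨τ.1.symm k, by simp [linkEquiv_inl]⟩
    simp only [hval hβ, himg]
    exact h
  · rintro ⟨β, τ⟩ hp ⟨β', τ'⟩ hp' he
    have hβ := hLP (Finset.mem_product.1 hp).1
    have hβ' := hLP (Finset.mem_product.1 hp').1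
    have he' : ∀ x, linkEquiv hβ (Equiv.sumCongr τ.1 τ.2 x) =
        linkEquiv hβ' (Equiv.sumCongr τ'.1 τ'.2 x) := by
      intro x
      rw [← hval hβ, ← hval hβ']
      exact congrArg (fun e : Equiv.Perm (Fin N ⊕ Fin N) => linkEquiv hα.1 (e x)) he
    have h1 : ∀ k, β.1 (τ.1 k) = β'.1 (τ'.1 k) := fun k => he' (Sum.inl k)
    obtain rfl : β = β' := by
      refine hβ.ext hβ' ?_
      change Set.range β.1 = Set.range β'.1
      rw [← τ.1.surjective.range_comp β.1, ← τ'.1.surjective.range_comp β'.1]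
      exact congrArg Set.range (funext h1)
    have h2 : ∀ k, β.2 (τ.2 k) = β.2 (τ'.2 k) := fun k => he' (Sum.inr k)
    have hτ1 : τ.1 = τ'.1 := Equiv.ext fun k => hβ.injective_fst (h1 k)
    have hτ2 : τ.2 = τ'.2 := Equiv.ext fun k => Sum.inr_injective (hβ.2.2.1.1 (h2 k))
    rw [Prod.ext hτ1 hτ2]
  · intro σ hσ
    have hinj : Function.Injective fun k => linkEquiv hα.1 (σ (Sum.inl k)) :=
      (linkEquiv hα.1).injective.comp (σ.injective.comp Sum.inl_injective)
    obtain ⟨β, hβ, hβA⟩ := hα.exists_isLP hsum (Finset.mem_filter.1 hσ).2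
    let ρ : Equiv.Perm (Fin N ⊕ Fin N) := (σ.trans (linkEquiv hα.1)).trans (linkEquiv hβ).symm
    have hρ : ρ ∈ (Equiv.Perm.sumCongrHom (Fin N) (Fin N)).range := by
      refine Equiv.Perm.mem_sumCongrHom_range_of_perm_mapsTo_inl ?_
      rintro _ ⟨k, rfl⟩
      have : linkEquiv hα.1 (σ (Sum.inl k)) ∈ opens β := by
        rw [hβA]
        exact Finset.mem_image_of_mem _ (Finset.mem_univ k)
      obtain ⟨l, -, hl⟩ := Finset.mem_image.1 this
      refine ⟨l, ?_⟩
      rw [← linkEquiv_inl hβ] at hl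
      simp only [ρ, Equiv.trans_apply, ← hl, Equiv.symm_apply_apply]
    obtain ⟨τ, hτ⟩ := hρ
    have hgeq := (hα.geqVal_iff hsum hβ).2 (by rw [hβA]; exact (Finset.mem_filter.1 hσ).2)
    refine ⟨(β, τ), Finset.mem_product.2 ⟨Finset.mem_filter.2
      ⟨Finset.mem_filter.2 ⟨Finset.mem_univ _, hβ⟩, hgeq⟩, Finset.mem_univ _⟩, ?_⟩
    have hτ' : Equiv.sumCongr τ.1 τ.2 = ρ := hτ
    simp only [hτ']
    ext x
    simp [ρ]
  · rintro ⟨β, τ⟩ hp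
    have hβ := hLP (Finset.mem_product.1 hp).1
    simp only [hval hβ, Equiv.sumCongr_apply, Sum.map_inl, Sum.map_inr, linkEquiv_inl,
      linkEquiv_inr, Matrix.of_apply]
    congr 1
    rw [Equiv.trans_assoc, Equiv.Perm.sign_trans, sign_linkEquiv_trans_symm hα.1 hβ, one_mul]
    exact (Equiv.Perm.sign_sumCongr τ.1 τ.2).symm

end Determinants

lemma InvDiffAlgebra.kern_eq {d : ℕ} {A : Type*} [CommRing A] [Algebra ℝ A]
    (S : InvDiffAlgebra d A) (u v : Fin d × ℕ) :
    S.kern u v = ((-1 : ℝ) ^ u.2 * ((v.2 + u.2 + 1).factorial : ℝ)) •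
      S.η u.1 v.1 ^ (v.2 + u.2 + 2) := by
  obtain ⟨i, m⟩ := u
  obtain ⟨k, n⟩ := v
  rw [InvDiffAlgebra.kern, InvDiffAlgebra.iter_η_sq]
  dsimp only
  induction m with
  | zero => simp
  | succ m ih =>
    rw [InvDiffAlgebra.iter_succ', ih, Derivation.map_smul, InvDiffAlgebra.D_η_pow, ← neg_smul,
      smul_smul, ← add_assoc n m 1, Nat.factorial_succ (n + m + 1), add_right_comm (n + m) 2 1]
    congr 1
    push_cast
    ring

section Positions

variable {N d : ℕ} {s : ℕ → ℕ}

/-- The group and offset of a position. -/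
def position (hsum : q s d = 2 * N) (t : Fin (2 * N)) : Fin d × ℕ :=
  (⟨grp d s t, grp_lt (by rw [hsum]; exact t.2)⟩, off d s t)

lemma chamberEval_kern (hsum : q s d = 2 * N) (x : Chamber d) (a b : Fin (2 * N)) :
    chamberEval x ((chamberStructure d).kern (position hsum a) (position hsum b)) =
      Real.pi * ker d s x.1 a b := by
  have hη : ∀ i k, chamberEval x ((chamberStructure d).η i k) = (x.1 i - x.1 k)⁻¹ :=
    fun _ _ => rfl
  have hπ := Real.pi_ne_zero
  rw [ker]
  by_cases h : grp d s a = grp d s b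
  · rw [if_pos h, mul_zero, InvDiffAlgebra.kern_of_eq, map_zero]
    exact Fin.ext h
  · rw [if_neg h]
    have hx : x.1 (position hsum a).1 - x.1 (position hsum b).1 ≠ 0 :=
      sub_ne_zero.2 (chamber_injOn x fun e => h (congrArg Fin.val e))
    by_cases hlt : grp d s a < grp d s b
    · have hx' := sub_ne_zero.2 (sub_ne_zero.1 hx).symm
      rw [InvDiffAlgebra.kern_comm, InvDiffAlgebra.kern_eq, map_smul, map_pow, hη, inv_pow]
      simp only [hlt, if_true, position, smul_eq_mul] at hx' ⊢
      field_simp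
    · rw [InvDiffAlgebra.kern_eq, map_smul, map_pow, hη, inv_pow]
      simp only [hlt, if_false, position, smul_eq_mul] at hx ⊢
      field_simp

lemma position_injective (hsum : q s d = 2 * N) : Function.Injective (position hsum) := by
  intro a b h
  have h1 : grp d s a = grp d s b := congrArg (fun p => (p.1 : ℕ)) h
  have h2 : off d s a = off d s b := congrArg Prod.snd h
  refine Fin.ext ?_
  rw [← q_add_off (d := d) (s := s) (t := a) (by rw [hsum]; exact a.2), h1, h2,
    q_add_off (by rw [hsum]; exact b.2)]

lemma q_add_lt (hsum : q s d = 2 * N) {j i : ℕ} (hj : j < d) (hi : i < s j) :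
    q s j + i < 2 * N := by
  have h := q_mono s (Nat.succ_le_of_lt hj)
  rw [Nat.succ_eq_add_one, q_succ, hsum] at h
  omega

lemma position_q_add (hsum : q s d = 2 * N) (j : Fin d) {i : ℕ} (hi : i < s j) :
    position hsum ⟨q s j + i, q_add_lt hsum j.2 hi⟩ = (j, i) :=
  Prod.ext (Fin.ext (grp_q_add j.2 hi)) (off_q_add j.2 hi)

lemma exists_position_eq_iff (hsum : q s d = 2 * N) (u : Fin d × ℕ) :
    (∃ t, position hsum t = u) ↔ u.2 < s u.1 := by
  constructor
  · rintro ⟨t, rfl⟩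
    exact off_lt (by rw [hsum]; exact t.2)
  · exact fun h => ⟨_, position_q_add hsum u.1 h⟩

/-- The sum of the determinants of the kernel over the link patterns `β ≥_ς α`. -/
noncomputable def InvDiffAlgebra.detSum {A : Type*} [CommRing A] [Algebra ℝ A]
    (S : InvDiffAlgebra d A) (hsum : q s d = 2 * N)
    (α : (Fin N → Fin (2 * N)) × (Fin N → Fin (2 * N))) : A :=
  ∑ β ∈ (LP N).filter (fun β => geqVal N d s β α), (Matrix.of fun k l =>
    S.kern (position hsum (β.1 k)) (position hsum (β.2 l))).det

/-- The Benoit–Saint-Aubin equation for the pairing at the positions of a link pattern, with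
the parameters `z` as a polynomial. -/
lemma InvDiffAlgebra.sum_prod_smul_bsaOp {A : Type*} [CommRing A] [Algebra ℝ A]
    (S : InvDiffAlgebra d A) (hsum : q s d = 2 * N)
    (e : Fin N ⊕ Fin N ≃ Fin (2 * N)) (j : Fin d) (c : ℝ) (φ : A →ₗ[ℝ] ℝ) (z : Fin d → ℝ) :
    ∑ σ : Equiv.Perm (Fin N ⊕ Fin N), (∏ k, z (position hsum (e (σ (Sum.inl k)))).1) *
      φ (bsaOp (S.lop (fun i => s i) j) (s j + 1) c (Equiv.Perm.sign σ •
        ∏ k, S.kern (position hsum (e (σ (Sum.inl k)))) (position hsum (e (σ (Sum.inr k)))))) =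
      0 := by
  have h := S.bsaOp_pairAlt z (s := fun i => s i) (fun t => position hsum (e t)) j
    (fun i => e.symm ⟨q s j + i, q_add_lt hsum j.2 i.2⟩)
    ((position_injective hsum).comp e.injective)
    (fun u => by
      rw [← exists_position_eq_iff hsum]
      exact ⟨fun ⟨t, ht⟩ => ⟨_, ht⟩, fun ⟨t, ht⟩ => ⟨e.symm t, by simpa using ht⟩⟩)
    (fun i => by simpa using position_q_add hsum j i.2) c
  rw [pairAlt_apply] at h
  simp only [InvDiffAlgebra.form_single, one_mul] at h
  rw [sum_sign_smul_prod_sub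
    (fun u v => S.kern (position hsum (e u)) (position hsum (e v))) (fun u v => S.kern_comm _ _)
    (fun t => z (position hsum (e t)).1), LinearMap.map_smul,
    smul_eq_zero_iff_right (by positivity), map_sum] at h
  have h' := congrArg φ h
  rw [map_zero, map_sum] at h'
  rw [← h']
  refine Finset.sum_congr rfl fun σ _ => ?_
  generalize Equiv.Perm.sign σ • ∏ k, S.kern (position hsum (e (σ (Sum.inl k))))
    (position hsum (e (σ (Sum.inr k)))) = a
  rw [LinearMap.map_smul, LinearMap.map_smul, smul_eq_mul]

lemma sum_single_position_apply (hsum : q s d = 2 * N) (f : Fin N → Fin (2 * N))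
    (hf : Function.Injective f) (i : Fin d) :
    (∑ k, Finsupp.single (position hsum (f k)).1 1 : Fin d →₀ ℕ) i =
      countGrp d s (Finset.univ.image f) i := by
  rw [countGrp_image f hf, Finset.card_filter, Finsupp.finsetSum_apply]
  refine Finset.sum_congr rfl fun k _ => ?_
  rw [Finsupp.single_apply]
  exact if_congr Fin.ext_iff rfl rfl

lemma sum_single_position_eq_iff (hsum : q s d = 2 * N) (f g : Fin N → Fin (2 * N))
    (hf : Function.Injective f) (hg : Function.Injective g) :
    (∑ k, Finsupp.single (position hsum (f k)).1 1 : Fin d →₀ ℕ) =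
      ∑ k, Finsupp.single (position hsum (g k)).1 1 ↔ ∀ i, i < d →
      countGrp d s (Finset.univ.image f) i = countGrp d s (Finset.univ.image g) i := by
  rw [DFunLike.ext_iff, Fin.forall_iff]
  refine forall₂_congr fun i hi => ?_
  rw [sum_single_position_apply hsum f hf, sum_single_position_apply hsum g hg]

/-- Every linear functional of the Benoit–Saint-Aubin combination of the sum of determinants
vanishes. -/
lemma InvDiffAlgebra.map_bsaOp_detSum {A : Type*} [CommRing A] [Algebra ℝ A]
    (S : InvDiffAlgebra d A) (hsum : q s d = 2 * N)
    {α : (Fin N → Fin (2 * N)) × (Fin N → Fin (2 * N))} (hα : valenced N d s α) (j : Fin d)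
    (c : ℝ) (φ : A →ₗ[ℝ] ℝ) :
    φ (bsaOp (S.lop (fun i => s i) j) (s j + 1) c (S.detSum hsum α)) = 0 := by
  have h1 := sum_filter_eq_zero_of_forall _ _
    (S.sum_prod_smul_bsaOp hsum (linkEquiv hα.1) j c φ)
    (∑ k, Finsupp.single (position hsum (α.1 k)).1 1)
  have hfilter := fun σ : Equiv.Perm (Fin N ⊕ Fin N) => sum_single_position_eq_iff hsum
    (fun k => linkEquiv hα.1 (σ (Sum.inl k))) α.1
    ((linkEquiv hα.1).injective.comp (σ.injective.comp Sum.inl_injective)) hα.1.injective_fst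
  simp only [hfilter] at h1
  rw [← map_sum, ← map_sum] at h1
  have h2 := hα.sum_sign_smul_prod hsum fun u v => S.kern (position hsum u) (position hsum v)
  rw [opens] at h2
  rw [h2, map_nsmul, map_nsmul, nsmul_eq_mul] at h1
  rw [InvDiffAlgebra.detSum]
  exact (mul_eq_zero.1 h1).resolve_left (Nat.cast_ne_zero.2 N.factorial_ne_zero)

lemma chamberEval_detSum (hsum : q s d = 2 * N)
    (α : (Fin N → Fin (2 * N)) × (Fin N → Fin (2 * N))) (x : Chamber d) :
    chamberEval x ((chamberStructure d).detSum hsum α) = Real.pi ^ N * U N d s α x.1 := by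
  rw [InvDiffAlgebra.detSum, map_sum, U, Finset.mul_sum]
  refine Finset.sum_congr rfl fun β _ => ?_
  have h : (chamberEval x).mapMatrix (Matrix.of fun k l : Fin N =>
      (chamberStructure d).kern (position hsum (β.1 k)) (position hsum (β.2 l))) =
      Real.pi • Matrix.of fun k l : Fin N => ker d s x.1 (β.1 k) (β.2 l) := by
    ext k l
    exact chamberEval_kern hsum x _ _
  rw [AlgHom.map_det, h, Matrix.det_smul, Fintype.card_fin, Δ]

end Positions

end UST

/-- Property (PDE) of Theorem D.2 of the paper: each explicit basis function `U_α`
satisfies the Benoit–Saint-Aubin BPZ PDE `D_{s_j+1}^{(j)} U_α = 0` of order `s_j + 1`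
at every marked point `x_j` (0-based `j` here), at central charge `c = −2`. -/
theorem stmt15 (N d : ℕ) (hN : 0 < N) (hd : 0 < d) (s : ℕ → ℕ)
    (hs : ∀ i, i < d → 0 < s i) (hsum : UST.q s d = 2 * N)
    (α : (Fin N → Fin (2 * N)) × (Fin N → Fin (2 * N)))
    (hα : UST.valenced N d s α)
    (j : ℕ) (hj : j < d) :
    ∀ x : ℕ → ℝ, UST.chamber d x →
      (∑ k ∈ Finset.Icc 1 (s j + 1),
        ∑ m ∈ (Finset.Nat.antidiagonalTuple k (s j + 1)).filter (fun m => ∀ i, 1 ≤ m i),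
          ((-2 : ℝ) ^ (s j + 1 - k) * (((s j).factorial : ℝ)) ^ 2 /
              ∏ l ∈ Finset.Ico 1 k,
                ((∑ i ∈ Finset.univ.filter (fun i : Fin k => (i : ℕ) < l), (m i : ℝ)) *
                  ∑ i ∈ Finset.univ.filter (fun i : Fin k => l ≤ (i : ℕ)), (m i : ℝ))) *
            ((List.ofFn m).foldr (UST.Lop d s j) (UST.U N d s α)) x) = 0 := by
  intro x hx
  have h := (UST.chamberStructure d).map_bsaOp_detSum hsum hα ⟨j, hj⟩
    ((((s j).factorial : ℝ)) ^ 2) (UST.chamberEval ⟨x, hx⟩).toLinearMap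
  have h' : UST.chamberEval ⟨x, hx⟩ (UST.bsaOp
      ((UST.chamberStructure d).lop (fun i => s i) ⟨j, hj⟩) (s j + 1)
      ((((s j).factorial : ℝ)) ^ 2)
      ((Real.pi ^ N)⁻¹ • (UST.chamberStructure d).detSum hsum α)) = 0 := by
    rw [LinearMap.map_smul, map_smul]
    exact smul_eq_zero_of_right _ h
  rw [← h', UST.bsaOp_apply, map_sum]
  refine Finset.sum_congr rfl fun k _ => ?_
  rw [map_sum]
  refine Finset.sum_congr rfl fun m hm => ?_
  rw [map_smul, smul_eq_mul]
  congr 1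
  refine UST.foldr_Lop_eq s ⟨j, hj⟩ (List.ofFn m) ?_ _ _ ?_ ⟨x, hx⟩
  · intro n hn
    obtain ⟨i, rfl⟩ := (List.mem_ofFn).1 hn
    exact (Finset.mem_filter.1 hm).2 i
  · intro y
    have := Real.pi_pos
    rw [map_smul, UST.chamberEval_detSum, smul_eq_mul, inv_mul_cancel_left₀ (by positivity)]
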